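/- Let a, b, c, d be complex numbers. The following conditions are equivalent: (1) ab = cd; (2) S(H_t(a,b)) = S(H_t(c,d)) for all t ∈ (−π, π]; (3) S(H_t(a,b)) = S(H_t(c,d)) for some t ∈ (−π, π]; (4) S(H(a,b)) = S(H(c,d)). -/

import Mathlib

open Real Complex Set

/-- The Mathieu potential `a·exp(−2πi x) + b·exp(2πi x)`. -/
noncomputable def mathieuPot (a b : ℂ) (x : ℝ) : ℂ :=
  a * Complex.exp (-(2 * Real.pi * Complex.I) * (x : ℂ)) +
    b * Complex.exp (2 * Real.pi * Complex.I * (x : ℂ))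

/-- `λ` is an eigenvalue of the operator `H_t(a,b)`: there is a twice continuously
differentiable function `y`, not identically zero on `[0,1]`, satisfying
`−y'' + (a e^{−2πix} + b e^{2πix}) y = λ y` on `[0,1]` with the `t`-quasiperiodic
boundary conditions. -/
def IsEigenvalueH (a b : ℂ) (t : ℝ) (lam : ℂ) : Prop :=
  ∃ y : ℝ → ℂ, ContDiff ℝ 2 y ∧
    (¬ ∀ x ∈ Set.Icc (0:ℝ) 1, y x = 0) ∧
    (∀ x ∈ Set.Icc (0:ℝ) 1,
      -(deriv (deriv y) x) + mathieuPot a b x * y x = lam * y x) ∧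
    y 1 = Complex.exp (Complex.I * t) * y 0 ∧
    deriv y 1 = Complex.exp (Complex.I * t) * deriv y 0

/-! ### Inverses of `1 - T` in a Banach space -/

section Banach

variable {E : Type*} [NormedAddCommGroup E] [NormedSpace ℂ E] [CompleteSpace E]

lemma isUnit_one_sub_of_norm_pow_lt_one {T : E →L[ℂ] E} {n : ℕ} (hT : ‖T ^ n‖ < 1) :
    IsUnit (1 - T) := by
  have h : IsUnit (1 - T ^ n) := isUnit_one_sub_of_norm_lt_one hT
  rw [← mul_neg_geom_sum] at h
  refine ((Commute.isUnit_mul_iff ?_).1 h).1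
  exact Commute.sub_left (Commute.one_left _)
    (Commute.sum_right _ _ _ fun i _ => Commute.self_pow _ i)

lemma differentiable_inverse_one_sub_apply {T : ℂ → E →L[ℂ] E} (hT : Differentiable ℂ T)
    (hunit : ∀ z, IsUnit (1 - T z)) (v : E) :
    Differentiable ℂ fun z => Ring.inverse (1 - T z) v := by
  intro z
  have h1 : DifferentiableAt ℂ (fun z => 1 - T z) z := (differentiableAt_const _).sub (hT z)
  have h2 : DifferentiableAt ℂ (fun z => Ring.inverse (1 - T z)) z :=
    DifferentiableAt.comp (g := Ring.inverse) z
      (differentiableAt_inverse (𝕜 := ℂ) (R := E →L[ℂ] E) (hunit z)) h1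
  exact h2.clm_apply (differentiableAt_const _)

end Banach

/-! ### The initial value problem for `y'' = Q y` on `[0, 2]` -/

/-- The primitive vanishing at `0` of the constant extension of `g` to the real line. -/
noncomputable def primFun (g : C(Icc (0 : ℝ) 2, ℂ)) (x : ℝ) : ℂ :=
  ∫ s in (0 : ℝ)..x, IccExtend (zero_le_two : (0 : ℝ) ≤ 2) g s

lemma continuous_IccExtend_zero_two (g : C(Icc (0 : ℝ) 2, ℂ)) :
    Continuous (IccExtend (zero_le_two : (0 : ℝ) ≤ 2) g) :=
  g.continuous.Icc_extend'

lemma hasDerivAt_primFun (g : C(Icc (0 : ℝ) 2, ℂ)) (x : ℝ) :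
    HasDerivAt (primFun g) (IccExtend (zero_le_two : (0 : ℝ) ≤ 2) g x) x :=
  ((continuous_IccExtend_zero_two g).integral_hasStrictDerivAt 0 x).hasDerivAt

lemma continuous_primFun (g : C(Icc (0 : ℝ) 2, ℂ)) : Continuous (primFun g) :=
  continuous_iff_continuousAt.2 fun x => (hasDerivAt_primFun g x).continuousAt

lemma norm_primFun_le {g : C(Icc (0 : ℝ) 2, ℂ)} {C : ℝ} {n : ℕ}
    (hg : ∀ x : Icc (0 : ℝ) 2, ‖g x‖ ≤ C * ((x : ℝ) ^ n / n.factorial)) (x : Icc (0 : ℝ) 2) :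
    ‖primFun g x‖ ≤ C * ((x : ℝ) ^ (n + 1) / (n + 1).factorial) := by
  have hx := x.2
  have h1 : ‖primFun g x‖ ≤ ∫ s in (0 : ℝ)..x, C * (s ^ n / n.factorial) := by
    refine intervalIntegral.norm_integral_le_of_norm_le hx.1 ?_ ?_
    · refine Filter.Eventually.of_forall fun s hs => ?_
      have hs' : s ∈ Icc (0 : ℝ) 2 := ⟨hs.1.le, hs.2.trans hx.2⟩
      rw [IccExtend_of_mem _ _ hs']
      exact hg ⟨s, hs'⟩
    · exact Continuous.intervalIntegrable (by fun_prop) _ _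
  refine h1.trans_eq ?_
  rw [intervalIntegral.integral_const_mul, intervalIntegral.integral_div, integral_pow]
  rw [Nat.factorial_succ]
  push_cast
  field_simp
  simp

lemma norm_primFun_le_two_mul (g : C(Icc (0 : ℝ) 2, ℂ)) (x : Icc (0 : ℝ) 2) :
    ‖primFun g x‖ ≤ 2 * ‖g‖ := by
  have h := norm_primFun_le (g := g) (C := ‖g‖) (n := 0)
    (fun x => by simpa using g.norm_coe_le_norm x) x
  have := mul_le_mul_of_nonneg_left x.2.2 (norm_nonneg g)
  simp only [zero_add, pow_one, Nat.factorial_one, Nat.cast_one, div_one] at h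
  linarith

/-- The operator of integration from `0` on continuous functions on `[0, 2]`. -/
noncomputable def primOp : C(Icc (0 : ℝ) 2, ℂ) →L[ℂ] C(Icc (0 : ℝ) 2, ℂ) :=
  LinearMap.mkContinuous
    { toFun := fun g => ⟨fun x => primFun g x, (continuous_primFun g).comp continuous_subtype_val⟩
      map_add' := fun f g => by
        ext x
        exact intervalIntegral.integral_add
          ((continuous_IccExtend_zero_two f).intervalIntegrable _ _)
          ((continuous_IccExtend_zero_two g).intervalIntegrable _ _)
      map_smul' := fun c g => by
        ext x
        exact intervalIntegral.integral_smul c _ }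
    2 (fun g => (ContinuousMap.norm_le _ (by positivity)).2 fun x => norm_primFun_le_two_mul g x)

lemma primOp_apply (g : C(Icc (0 : ℝ) 2, ℂ)) (x : Icc (0 : ℝ) 2) :
    primOp g x = primFun g x := rfl

/-- The integral operator of the initial value problem for `y'' = Q y`. -/
noncomputable def volterraOp (Q : C(Icc (0 : ℝ) 2, ℂ)) :
    C(Icc (0 : ℝ) 2, ℂ) →L[ℂ] C(Icc (0 : ℝ) 2, ℂ) :=
  primOp * primOp * ContinuousLinearMap.mul ℂ _ Q

lemma norm_volterraOp_pow_apply_le (Q y : C(Icc (0 : ℝ) 2, ℂ)) (n : ℕ) (x : Icc (0 : ℝ) 2) :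
    ‖(volterraOp Q ^ n) y x‖ ≤ ‖Q‖ ^ n * ‖y‖ * ((x : ℝ) ^ (2 * n) / (2 * n).factorial) := by
  induction n generalizing x with
  | zero => simpa using y.norm_coe_le_norm x
  | succ n ih =>
    rw [pow_succ']
    change ‖primFun (primOp (Q * (volterraOp Q ^ n) y)) x‖ ≤ _
    refine norm_primFun_le (n := 2 * n + 1) (fun x => ?_) x
    refine norm_primFun_le (n := 2 * n) (fun x => ?_) x
    rw [ContinuousMap.mul_apply, norm_mul, pow_succ']
    calc _ ≤ ‖Q‖ * (‖Q‖ ^ n * ‖y‖ * ((x : ℝ) ^ (2 * n) / (2 * n).factorial)) :=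
          mul_le_mul (Q.norm_coe_le_norm x) (ih x) (norm_nonneg _) (norm_nonneg _)
      _ = _ := by ring

lemma isUnit_one_sub_volterraOp (Q : C(Icc (0 : ℝ) 2, ℂ)) : IsUnit (1 - volterraOp Q) := by
  have hlim : Filter.Tendsto (fun n : ℕ => (2 * √‖Q‖) ^ (2 * n) / (2 * n).factorial)
      Filter.atTop (nhds 0) :=
    (FloorSemiring.tendsto_pow_div_factorial_atTop (2 * √‖Q‖)).comp
      (Filter.tendsto_id.const_mul_atTop' two_pos)
  obtain ⟨n, hn⟩ := (hlim.eventually (gt_mem_nhds zero_lt_one)).exists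
  have hnorm : ‖volterraOp Q ^ n‖ < 1 := by
    refine lt_of_le_of_lt (ContinuousLinearMap.opNorm_le_bound _ (by positivity) fun y => ?_) hn
    refine (ContinuousMap.norm_le _ (by positivity)).2 fun x =>
      (norm_volterraOp_pow_apply_le Q y n x).trans ?_
    have hx : (x : ℝ) ^ (2 * n) ≤ 2 ^ (2 * n) := pow_le_pow_left₀ x.2.1 x.2.2 _
    rw [mul_pow, pow_mul (√‖Q‖), Real.sq_sqrt (norm_nonneg _)]
    calc ‖Q‖ ^ n * ‖y‖ * ((x : ℝ) ^ (2 * n) / (2 * n).factorial)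
        ≤ ‖Q‖ ^ n * ‖y‖ * (2 ^ (2 * n) / (2 * n).factorial) := by gcongr
      _ = _ := by ring
  exact isUnit_one_sub_of_norm_pow_lt_one (E := C(Icc (0 : ℝ) 2, ℂ)) hnorm

/-- The inclusion of `[0, 2]` into the complex numbers. -/
noncomputable def coordMap : C(Icc (0 : ℝ) 2, ℂ) := ⟨fun x => ((x : ℝ) : ℂ), by fun_prop⟩

/-- The solution on `[0, 2]` of `y'' = Q y`, `y(0) = c₀`, `y'(0) = c₁`. -/
noncomputable def ivpSol (Q : C(Icc (0 : ℝ) 2, ℂ)) (c₀ c₁ : ℂ) : C(Icc (0 : ℝ) 2, ℂ) :=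
  Ring.inverse (1 - volterraOp Q) (c₀ • 1 + c₁ • coordMap)

/-- The derivative of `ivpExt`. -/
noncomputable def ivpDeriv (Q : C(Icc (0 : ℝ) 2, ℂ)) (c₀ c₁ : ℂ) (x : ℝ) : ℂ :=
  c₁ + primFun (Q * ivpSol Q c₀ c₁) x

/-- A twice continuously differentiable extension of `ivpSol` to the real line. -/
noncomputable def ivpExt (Q : C(Icc (0 : ℝ) 2, ℂ)) (c₀ c₁ : ℂ) (x : ℝ) : ℂ :=
  c₀ + ∫ s in (0 : ℝ)..x, ivpDeriv Q c₀ c₁ s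

section ivp

variable (Q : C(Icc (0 : ℝ) 2, ℂ)) (c₀ c₁ : ℂ)

lemma hasDerivAt_ivpDeriv (x : ℝ) : HasDerivAt (ivpDeriv Q c₀ c₁)
    (IccExtend (zero_le_two : (0 : ℝ) ≤ 2) ⇑(Q * ivpSol Q c₀ c₁) x) x :=
  (hasDerivAt_primFun _ x).const_add c₁

lemma continuous_ivpDeriv : Continuous (ivpDeriv Q c₀ c₁) :=
  continuous_const.add (continuous_primFun _)

lemma hasDerivAt_ivpExt (x : ℝ) : HasDerivAt (ivpExt Q c₀ c₁) (ivpDeriv Q c₀ c₁ x) x :=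
  (((continuous_ivpDeriv Q c₀ c₁).integral_hasStrictDerivAt 0 x).hasDerivAt).const_add c₀

lemma deriv_ivpExt : deriv (ivpExt Q c₀ c₁) = ivpDeriv Q c₀ c₁ :=
  funext fun x => (hasDerivAt_ivpExt Q c₀ c₁ x).deriv

lemma contDiff_ivpExt : ContDiff ℝ 2 (ivpExt Q c₀ c₁) := by
  rw [show (2 : WithTop ℕ∞) = 1 + 1 from one_add_one_eq_two.symm, contDiff_succ_iff_deriv]
  refine ⟨fun x => (hasDerivAt_ivpExt Q c₀ c₁ x).differentiableAt, by simp, ?_⟩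
  rw [deriv_ivpExt, contDiff_one_iff_deriv]
  refine ⟨fun x => (hasDerivAt_ivpDeriv Q c₀ c₁ x).differentiableAt, ?_⟩
  rw [show deriv (ivpDeriv Q c₀ c₁) = _ from
    funext fun x => (hasDerivAt_ivpDeriv Q c₀ c₁ x).deriv]
  exact continuous_IccExtend_zero_two _

lemma ivpExt_zero : ivpExt Q c₀ c₁ 0 = c₀ := by simp [ivpExt]

lemma ivpDeriv_zero : ivpDeriv Q c₀ c₁ 0 = c₁ := by simp [ivpDeriv, primFun]

lemma ivpSol_eq : ivpSol Q c₀ c₁ =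
    c₀ • 1 + c₁ • coordMap + primOp (primOp (Q * ivpSol Q c₀ c₁)) := by
  have h : (1 - volterraOp Q) (ivpSol Q c₀ c₁) = c₀ • 1 + c₁ • coordMap := by
    have := Ring.mul_inverse_cancel _ (isUnit_one_sub_volterraOp Q)
    exact congrArg (fun T : C(Icc (0 : ℝ) 2, ℂ) →L[ℂ] C(Icc (0 : ℝ) 2, ℂ) =>
      T (c₀ • 1 + c₁ • coordMap)) this
  rw [← h]
  simp [volterraOp]

lemma ivpExt_eq_ivpSol (x : Icc (0 : ℝ) 2) : ivpExt Q c₀ c₁ x = ivpSol Q c₀ c₁ x := by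
  rw [ivpSol_eq Q c₀ c₁]
  simp only [ivpExt, ivpDeriv, ContinuousMap.add_apply, ContinuousMap.smul_apply,
    ContinuousMap.one_apply, primOp_apply]
  rw [intervalIntegral.integral_add (by simp) ((continuous_primFun _).intervalIntegrable _ _)]
  rw [add_assoc]
  have h : ∫ s in (0 : ℝ)..x, primFun (Q * ivpSol Q c₀ c₁) s =
      primFun (primOp (Q * ivpSol Q c₀ c₁)) x := by
    refine intervalIntegral.integral_congr fun s hs => ?_
    rw [uIcc_of_le x.2.1] at hs
    exact (IccExtend_of_mem (zero_le_two : (0 : ℝ) ≤ 2) (primOp (Q * ivpSol Q c₀ c₁))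
      ⟨hs.1, hs.2.trans x.2.2⟩).symm
  rw [h]
  simp [coordMap, mul_comm]

lemma deriv_deriv_ivpExt (x : Icc (0 : ℝ) 2) :
    deriv (deriv (ivpExt Q c₀ c₁)) x = Q x * ivpExt Q c₀ c₁ x := by
  rw [deriv_ivpExt, (hasDerivAt_ivpDeriv Q c₀ c₁ x).deriv, IccExtend_val,
    ContinuousMap.mul_apply, ivpExt_eq_ivpSol]

end ivp

section ParameterDependence

variable {Q : ℂ → C(Icc (0 : ℝ) 2, ℂ)}

lemma differentiable_ivpSol (hQ : Differentiable ℂ Q) (c₀ c₁ : ℂ) :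
    Differentiable ℂ fun z => ivpSol (Q z) c₀ c₁ := by
  refine differentiable_inverse_one_sub_apply (E := C(Icc (0 : ℝ) 2, ℂ)) ?_
    (fun z => isUnit_one_sub_volterraOp (Q z)) _
  exact (ContinuousLinearMap.compL ℂ C(Icc (0 : ℝ) 2, ℂ) C(Icc (0 : ℝ) 2, ℂ)
    C(Icc (0 : ℝ) 2, ℂ) (primOp * primOp)).differentiable.comp
      ((ContinuousLinearMap.mul ℂ C(Icc (0 : ℝ) 2, ℂ)).differentiable.comp hQ)

lemma differentiable_ivpExt_one (hQ : Differentiable ℂ Q) (c₀ c₁ : ℂ) :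
    Differentiable ℂ fun z => ivpExt (Q z) c₀ c₁ 1 := by
  have h (z : ℂ) : ivpExt (Q z) c₀ c₁ 1 =
      ContinuousMap.evalCLM ℂ ⟨1, by norm_num⟩ (ivpSol (Q z) c₀ c₁) :=
    ivpExt_eq_ivpSol (Q z) c₀ c₁ ⟨1, by norm_num⟩
  simp only [h]
  exact (ContinuousLinearMap.differentiable _).comp (differentiable_ivpSol hQ c₀ c₁)

lemma differentiable_ivpDeriv_one (hQ : Differentiable ℂ Q) (c₀ c₁ : ℂ) :
    Differentiable ℂ fun z => ivpDeriv (Q z) c₀ c₁ 1 := by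
  have h (z : ℂ) : ivpDeriv (Q z) c₀ c₁ 1 =
      c₁ + ContinuousMap.evalCLM ℂ ⟨1, by norm_num⟩ (primOp (Q z * ivpSol (Q z) c₀ c₁)) := rfl
  simp only [h]
  exact ((ContinuousLinearMap.differentiable _).comp ((ContinuousLinearMap.differentiable _).comp
    (hQ.mul (differentiable_ivpSol hQ c₀ c₁)))).const_add _

end ParameterDependence

/-! ### Solutions on an interval -/

/-- `y` is twice continuously differentiable and solves `y'' = Q y` on `[0, L]`. -/
def SolvesOn (Q : ℝ → ℂ) (L : ℝ) (y : ℝ → ℂ) : Prop :=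
  ContDiff ℝ 2 y ∧ ∀ x ∈ Icc (0 : ℝ) L, deriv (deriv y) x = Q x * y x

namespace SolvesOn

variable {Q : ℝ → ℂ} {L : ℝ} {y z : ℝ → ℂ}

lemma contDiff_deriv (hy : SolvesOn Q L y) : ContDiff ℝ 1 (deriv y) := by
  have h := hy.1
  rw [show (2 : WithTop ℕ∞) = 1 + 1 from one_add_one_eq_two.symm, contDiff_succ_iff_deriv] at h
  exact h.2.2

lemma hasDerivAt (hy : SolvesOn Q L y) (x : ℝ) : HasDerivAt y (deriv y x) x :=
  (hy.1.differentiable (by norm_num) x).hasDerivAt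

lemma hasDerivAt_deriv (hy : SolvesOn Q L y) (x : ℝ) :
    HasDerivAt (deriv y) (deriv (deriv y) x) x :=
  (hy.contDiff_deriv.differentiable (by norm_num) x).hasDerivAt

lemma continuous_deriv_deriv (hy : SolvesOn Q L y) : Continuous (deriv (deriv y)) :=
  hy.contDiff_deriv.continuous_deriv (by norm_num)

lemma mono {L' : ℝ} (hy : SolvesOn Q L y) (hL : L' ≤ L) : SolvesOn Q L' y :=
  ⟨hy.1, fun x hx => hy.2 x ⟨hx.1, hx.2.trans hL⟩⟩

lemma deriv_combination (hy : SolvesOn Q L y) (hz : SolvesOn Q L z) (c d : ℂ) :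
    deriv (fun x => c * y x + d * z x) = fun x => c * deriv y x + d * deriv z x :=
  funext fun x => (((hy.hasDerivAt x).const_mul c).add ((hz.hasDerivAt x).const_mul d)).deriv

lemma combination (hy : SolvesOn Q L y) (hz : SolvesOn Q L z) (c d : ℂ) :
    SolvesOn Q L fun x => c * y x + d * z x := by
  refine ⟨(contDiff_const.mul hy.1).add (contDiff_const.mul hz.1), fun x hx => ?_⟩
  have h : deriv (fun x => c * deriv y x + d * deriv z x) x = _ :=
    (((hy.hasDerivAt_deriv x).const_mul c).add ((hz.hasDerivAt_deriv x).const_mul d)).deriv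
  rw [deriv_combination hy hz, h, hy.2 x hx, hz.2 x hx]
  ring

lemma eq_zero_of_initial (hQ : Continuous Q) (hy : SolvesOn Q L y) (h0 : y 0 = 0)
    (h1 : deriv y 0 = 0) {x : ℝ} (hx : x ∈ Icc (0 : ℝ) L) : y x = 0 ∧ deriv y x = 0 := by
  obtain ⟨C, hC⟩ := isCompact_Icc.exists_bound_of_continuousOn (s := Icc (0 : ℝ) L)
    hQ.continuousOn
  have key := eq_zero_of_abs_deriv_le_mul_abs_self_of_eq_zero_right
    (f := fun x => (y x, deriv y x)) (f' := fun x => (deriv y x, deriv (deriv y) x))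
    (K := max 1 C) (a := 0) (b := L)
    ((hy.1.continuous.prodMk (hy.contDiff_deriv.continuous)).continuousOn)
    (fun x _ => ((hy.hasDerivAt x).prodMk (hy.hasDerivAt_deriv x)).hasDerivWithinAt)
    (by simp [h0, h1]) (fun x hx => ?_) x hx
  · simpa using key
  · have hx' := Ico_subset_Icc_self hx
    refine norm_prod_le_iff.2 ⟨?_, ?_⟩
    · calc ‖deriv y x‖ ≤ 1 * ‖(y x, deriv y x)‖ := by
            rw [one_mul]; exact norm_snd_le (y x, deriv y x)
        _ ≤ _ := by gcongr; exact le_max_left _ _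
    · change ‖deriv (deriv y) x‖ ≤ _
      rw [hy.2 x hx', norm_mul]
      exact mul_le_mul ((hC x hx').trans (le_max_right _ _)) (norm_fst_le (y x, deriv y x))
        (norm_nonneg _) (by positivity)

lemma eq_of_initial (hQ : Continuous Q) (hy : SolvesOn Q L y) (hz : SolvesOn Q L z)
    (h0 : y 0 = z 0) (h1 : deriv y 0 = deriv z 0) {x : ℝ} (hx : x ∈ Icc (0 : ℝ) L) :
    y x = z x ∧ deriv y x = deriv z x := by
  have h := (hy.combination hz 1 (-1)).eq_zero_of_initial hQ
    (by simp [h0]) (by rw [deriv_combination hy hz]; simp [h1]) hx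
  rw [deriv_combination hy hz] at h
  simpa only [one_mul, neg_mul, ← sub_eq_add_neg, sub_eq_zero] using h

lemma wronskian_eq (hy : SolvesOn Q L y) (hz : SolvesOn Q L z) {x : ℝ}
    (hx : x ∈ Icc (0 : ℝ) L) :
    y x * deriv z x - deriv y x * z x = y 0 * deriv z 0 - deriv y 0 * z 0 := by
  have hd (x : ℝ) := ((hy.hasDerivAt x).mul (hz.hasDerivAt_deriv x)).sub
    ((hy.hasDerivAt_deriv x).mul (hz.hasDerivAt x))
  refine constant_of_has_deriv_right_zero (a := 0) (b := L)
    (f := fun x => y x * deriv z x - deriv y x * z x)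
    (fun x _ => (hd x).continuousAt.continuousWithinAt) (fun x hx => ?_) x hx
  have hx' := Ico_subset_Icc_self hx
  refine ((hd x).congr_deriv ?_).hasDerivWithinAt
  rw [hy.2 x hx', hz.2 x hx']
  ring

lemma comp_add_const (hy : SolvesOn Q L y) {s : ℝ} (hs : 0 ≤ s) :
    SolvesOn (fun x => Q (x + s)) (L - s) fun x => y (x + s) := by
  have hd : deriv (fun x => y (x + s)) = fun x => deriv y (x + s) :=
    funext fun x => deriv_comp_add_const _ _ _
  refine ⟨hy.1.comp (contDiff_id.add contDiff_const), fun x hx => ?_⟩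
  rw [hd, deriv_comp_add_const]
  exact hy.2 (x + s) ⟨by linarith [hx.1], by linarith [hx.2]⟩

end SolvesOn

/-! ### The Hill discriminant of the Mathieu equation -/

lemma continuous_mathieuPot (a b : ℂ) : Continuous (mathieuPot a b) := by
  unfold mathieuPot; fun_prop

lemma continuous_mathieuPot_sub (a b lam : ℂ) : Continuous fun x => mathieuPot a b x - lam :=
  (continuous_mathieuPot a b).sub continuous_const

lemma mathieuPot_add (a b : ℂ) (x s : ℝ) : mathieuPot a b (x + s) =
    mathieuPot (a * Complex.exp (-(2 * Real.pi * Complex.I * s)))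
      (b * Complex.exp (2 * Real.pi * Complex.I * s)) x := by
  simp only [mathieuPot, mul_assoc, ← Complex.exp_add]
  push_cast
  ring_nf

lemma mathieuPot_add_one (a b : ℂ) (x : ℝ) : mathieuPot a b (x + 1) = mathieuPot a b x := by
  rw [mathieuPot_add]
  simp [Complex.exp_neg]

/-- The function `V - lam` on `[0, 2]`, with `V` the Mathieu potential. -/
noncomputable def mathieuCoeff (a b lam : ℂ) : C(Icc (0 : ℝ) 2, ℂ) :=
  ⟨fun x => mathieuPot a b x - lam,
    (continuous_mathieuPot_sub a b lam).comp continuous_subtype_val⟩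

lemma differentiable_mathieuCoeff {a b lam : ℂ → ℂ} (ha : Differentiable ℂ a)
    (hb : Differentiable ℂ b) (hlam : Differentiable ℂ lam) :
    Differentiable ℂ fun z => mathieuCoeff (a z) (b z) (lam z) := by
  have h (z : ℂ) : mathieuCoeff (a z) (b z) (lam z) =
      a z • mathieuCoeff 1 0 0 + b z • mathieuCoeff 0 1 0 - lam z • (1 : C(Icc (0 : ℝ) 2, ℂ)) := by
    ext x
    simp [mathieuCoeff, mathieuPot]
  simp only [h]
  exact ((ha.smul_const _).add (hb.smul_const _)).sub (hlam.smul_const _)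

lemma solvesOn_ivpExt (a b lam c₀ c₁ : ℂ) :
    SolvesOn (fun x => mathieuPot a b x - lam) 2 (ivpExt (mathieuCoeff a b lam) c₀ c₁) :=
  ⟨contDiff_ivpExt _ _ _, fun x hx => deriv_deriv_ivpExt _ _ _ ⟨x, hx⟩⟩

/-- The Hill discriminant: the trace of the monodromy matrix. -/
noncomputable def hillDiscr (a b lam : ℂ) : ℂ :=
  ivpExt (mathieuCoeff a b lam) 1 0 1 + ivpDeriv (mathieuCoeff a b lam) 0 1 1

lemma differentiable_hillDiscr {a b lam : ℂ → ℂ} (ha : Differentiable ℂ a)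
    (hb : Differentiable ℂ b) (hlam : Differentiable ℂ lam) :
    Differentiable ℂ fun z => hillDiscr (a z) (b z) (lam z) :=
  (differentiable_ivpExt_one (differentiable_mathieuCoeff ha hb hlam) 1 0).add
    (differentiable_ivpDeriv_one (differentiable_mathieuCoeff ha hb hlam) 0 1)

/-- There is a nontrivial solution with Floquet multiplier `ρ`. -/
def HasMultiplier (a b lam ρ : ℂ) : Prop :=
  ∃ y : ℝ → ℂ, SolvesOn (fun x => mathieuPot a b x - lam) 1 y ∧
    ¬ (y 0 = 0 ∧ deriv y 0 = 0) ∧ y 1 = ρ * y 0 ∧ deriv y 1 = ρ * deriv y 0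

lemma isEigenvalueH_iff_hasMultiplier (a b : ℂ) (t : ℝ) (lam : ℂ) :
    IsEigenvalueH a b t lam ↔ HasMultiplier a b lam (Complex.exp (Complex.I * t)) := by
  constructor
  · rintro ⟨y, hy, hne, hode, h⟩
    have hs : SolvesOn (fun x => mathieuPot a b x - lam) 1 y :=
      ⟨hy, fun x hx => by linear_combination -hode x hx⟩
    exact ⟨y, hs, fun h0 => hne fun x hx => (hs.eq_zero_of_initial
      (continuous_mathieuPot_sub a b lam) h0.1 h0.2 hx).1, h⟩
  · rintro ⟨y, hs, hne, h⟩
    refine ⟨y, hs.1, fun h0 => hne ⟨h0 0 (by simp), ?_⟩,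
      fun x hx => by linear_combination -hs.2 x hx, h⟩
    have h1 : HasDerivWithinAt y 0 (Icc 0 1) 0 :=
      (hasDerivWithinAt_const (0 : ℝ) (Icc (0 : ℝ) 1) (0 : ℂ)).congr h0 (h0 0 (by simp))
    exact (uniqueDiffOn_Icc zero_lt_one 0 (by simp)).eq_deriv _
      (hs.hasDerivAt 0).hasDerivWithinAt h1

lemma hasMultiplier_iff (a b lam : ℂ) {ρ : ℂ} (hρ : ρ ≠ 0) :
    HasMultiplier a b lam ρ ↔ hillDiscr a b lam = ρ + ρ⁻¹ := by
  have hQ := continuous_mathieuPot_sub a b lam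
  have h01 : (1 : ℝ) ∈ Icc (0 : ℝ) 1 := by simp
  have hu := (solvesOn_ivpExt a b lam 1 0).mono one_le_two
  have hv := (solvesOn_ivpExt a b lam 0 1).mono one_le_two
  have hW := hu.wronskian_eq hv h01
  have hD : hillDiscr a b lam = ivpExt (mathieuCoeff a b lam) 1 0 1
      + deriv (ivpExt (mathieuCoeff a b lam) 0 1) 1 := by rw [deriv_ivpExt]; rfl
  have hu0 : ivpExt (mathieuCoeff a b lam) 1 0 0 = 1 := ivpExt_zero _ _ _
  have hv0 : ivpExt (mathieuCoeff a b lam) 0 1 0 = 0 := ivpExt_zero _ _ _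
  have hu1 : deriv (ivpExt (mathieuCoeff a b lam) 1 0) 0 = 0 := by
    rw [deriv_ivpExt, ivpDeriv_zero]
  have hv1 : deriv (ivpExt (mathieuCoeff a b lam) 0 1) 0 = 1 := by
    rw [deriv_ivpExt, ivpDeriv_zero]
  rw [hu0, hv0, hu1, hv1] at hW
  rw [hD]
  generalize ivpExt (mathieuCoeff a b lam) 1 0 = u at *
  generalize ivpExt (mathieuCoeff a b lam) 0 1 = v at *
  have hdet : u 1 + deriv v 1 = ρ + ρ⁻¹ ↔
      !![u 1 - ρ, v 1; deriv u 1, deriv v 1 - ρ].det = 0 := by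
    rw [Matrix.det_fin_two_of, ← sub_eq_zero]
    have : (u 1 - ρ) * (deriv v 1 - ρ) - v 1 * deriv u 1 =
        -ρ * (u 1 + deriv v 1 - (ρ + ρ⁻¹)) := by
      linear_combination hW - mul_inv_cancel₀ hρ
    rw [this, mul_eq_zero]
    simp [hρ]
  rw [hdet, ← Matrix.exists_mulVec_eq_zero_iff]
  constructor
  · rintro ⟨y, hy, hne, h0, h1⟩
    have hyuv := hy.eq_of_initial hQ (hu.combination hv (y 0) (deriv y 0))
      (by simp [hu0, hv0]) (by simp [hu.deriv_combination hv, hu1, hv1]) h01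
    simp only [hu.deriv_combination hv] at hyuv
    refine ⟨![y 0, deriv y 0], fun h => hne ⟨congrFun h 0, congrFun h 1⟩, ?_⟩
    ext i
    fin_cases i
    · simp [Matrix.mulVec, dotProduct]
      linear_combination h0 - hyuv.1
    · simp [Matrix.mulVec, dotProduct]
      linear_combination h1 - hyuv.2
  · rintro ⟨c, hc, hMc⟩
    have e0 := congrFun hMc 0
    have e1 := congrFun hMc 1
    simp [Matrix.mulVec, dotProduct] at e0 e1
    refine ⟨_, hu.combination hv (c 0) (c 1), ?_, ?_, ?_⟩
    · simp only [hu.deriv_combination hv, hu0, hu1, hv0, hv1]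
      rintro ⟨h0, h1⟩
      refine hc (funext fun i => ?_)
      fin_cases i
      · simpa using h0
      · simpa using h1
    · simp only [hu0, hv0]
      linear_combination e0
    · simp only [hu.deriv_combination hv, hu1, hv1]
      linear_combination e1

lemma isEigenvalueH_iff (a b : ℂ) (t : ℝ) (lam : ℂ) :
    IsEigenvalueH a b t lam ↔ hillDiscr a b lam = 2 * Complex.cos t := by
  rw [isEigenvalueH_iff_hasMultiplier, hasMultiplier_iff _ _ _ (Complex.exp_ne_zero _),
    ← Complex.exp_neg, Complex.two_cos, mul_comm Complex.I]
  simp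

/-! ### The discriminant depends only on the product of the coefficients -/

lemma HasMultiplier.shift {a b lam ρ : ℂ} (hρ : ρ ≠ 0) (h : HasMultiplier a b lam ρ) {s : ℝ}
    (hs : s ∈ Icc (0 : ℝ) 1) :
    HasMultiplier (a * Complex.exp (-(2 * Real.pi * Complex.I * s)))
      (b * Complex.exp (2 * Real.pi * Complex.I * s)) lam ρ := by
  have hQ := continuous_mathieuPot_sub a b lam
  obtain ⟨y, hy, hne, h0, h1⟩ := h
  have hY := solvesOn_ivpExt a b lam (y 0) (deriv y 0)
  have hY0 : ivpExt (mathieuCoeff a b lam) (y 0) (deriv y 0) 0 = y 0 := ivpExt_zero _ _ _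
  have hY1 : deriv (ivpExt (mathieuCoeff a b lam) (y 0) (deriv y 0)) 0 = deriv y 0 := by
    rw [deriv_ivpExt, ivpDeriv_zero]
  generalize ivpExt (mathieuCoeff a b lam) (y 0) (deriv y 0) = Y at *
  have hYy := (hY.mono one_le_two).eq_of_initial hQ hy hY0 hY1 (x := 1) (by simp)
  have hper {x : ℝ} (hx : x ∈ Icc (0 : ℝ) 1) :
      Y (x + 1) = ρ * Y x ∧ deriv Y (x + 1) = ρ * deriv Y x := by
    have hz := hY.comp_add_const zero_le_one
    rw [show (2 : ℝ) - 1 = 1 by norm_num] at hz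
    simp only [mathieuPot_add_one] at hz
    have hY' := hY.mono one_le_two
    have := hz.eq_of_initial hQ (hY'.combination hY' ρ 0)
      (by simp [hYy, h0, hY0])
      (by simp [deriv_comp_add_const, hYy, h1, hY1]) hx
    simpa [hY'.deriv_combination hY', deriv_comp_add_const] using this
  have hw := (hY.comp_add_const hs.1).mono (L' := 1) (by linarith [hs.2])
  refine ⟨fun x => Y (x + s), ?_, ?_, ?_, ?_⟩
  · simpa only [← mathieuPot_add] using hw
  · rintro ⟨e0, e1⟩
    have hz := hw.eq_zero_of_initial (hQ.comp (continuous_id.add continuous_const)) e0 e1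
      (x := 1 - s) ⟨by linarith [hs.2], by linarith [hs.1]⟩
    simp only [deriv_comp_add_const, sub_add_cancel] at hz
    rw [hYy.1, hYy.2, h0, h1] at hz
    simp only [mul_eq_zero, hρ, false_or] at hz
    exact hne hz
  · simpa [add_comm] using (hper hs).1
  · simp only [deriv_comp_add_const, zero_add, add_comm (1 : ℝ) s]
    exact (hper hs).2

lemma exists_add_inv_eq (D : ℂ) : ∃ ρ : ℂ, ρ ≠ 0 ∧ D = ρ + ρ⁻¹ := by
  obtain ⟨z, hz⟩ := Complex.cos_surjective (D / 2)
  refine ⟨Complex.exp (z * Complex.I), Complex.exp_ne_zero _, ?_⟩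
  rw [← Complex.exp_neg, ← neg_mul, ← Complex.two_cos, hz]
  ring

lemma hillDiscr_shift (a b lam : ℂ) {s : ℝ} (hs : s ∈ Icc (0 : ℝ) 1) :
    hillDiscr (a * Complex.exp (-(2 * Real.pi * Complex.I * s)))
      (b * Complex.exp (2 * Real.pi * Complex.I * s)) lam = hillDiscr a b lam := by
  obtain ⟨ρ, hρ, h⟩ := exists_add_inv_eq (hillDiscr a b lam)
  rw [h, ← hasMultiplier_iff _ _ _ hρ]
  exact ((hasMultiplier_iff _ _ _ hρ).2 h).shift hρ hs

lemma eq_const_of_frequently {f : ℂ → ℂ} (hf : Differentiable ℂ f) {z₀ c : ℂ}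
    (h : ∃ᶠ z in nhdsWithin z₀ {z₀}ᶜ, f z = c) (z : ℂ) : f z = c :=
  congrFun (AnalyticOnNhd.eq_of_frequently_eq (g := fun _ => c)
    (fun z _ => hf.analyticAt z) (fun _ _ => analyticAt_const) h) z

lemma hillDiscr_exp (a b lam w : ℂ) :
    hillDiscr (a * Complex.exp (-w)) (b * Complex.exp w) lam = hillDiscr a b lam := by
  refine eq_const_of_frequently (z₀ := 0)
    (f := fun w => hillDiscr (a * Complex.exp (-w)) (b * Complex.exp w) lam)
    (differentiable_hillDiscr (by fun_prop) (by fun_prop) (by fun_prop)) ?_ w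
  have hlim : Filter.Tendsto (fun n : ℕ => 2 * Real.pi * Complex.I * ((1 / ((n : ℝ) + 1) : ℝ) : ℂ))
      Filter.atTop (nhdsWithin 0 {0}ᶜ) := by
    refine tendsto_nhdsWithin_iff.2 ⟨?_, Filter.Eventually.of_forall fun n => ?_⟩
    · have h := (Complex.continuous_ofReal.tendsto 0).comp
        (tendsto_one_div_add_atTop_nhds_zero_nat (𝕜 := ℝ))
      simpa using h.const_mul (2 * Real.pi * Complex.I)
    · have : ((n : ℂ) + 1) ≠ 0 := Nat.cast_add_one_ne_zero n
      simp [Real.pi_ne_zero, this]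
  refine hlim.frequently (Filter.Frequently.of_forall fun n => ?_)
  refine hillDiscr_shift a b lam ⟨by positivity, ?_⟩
  rw [div_le_one (by positivity)]
  linarith [Nat.cast_nonneg (α := ℝ) n]

lemma hillDiscr_zero_right (a lam : ℂ) : hillDiscr a 0 lam = hillDiscr 0 0 lam := by
  refine Eq.symm ?_
  have := eq_const_of_frequently (z₀ := 0) (c := hillDiscr a 0 lam)
    (f := fun z => hillDiscr (a * z) 0 lam)
    (differentiable_hillDiscr (by fun_prop) (by fun_prop) (by fun_prop)) ?_ 0
  · simpa using this
  · refine Filter.Eventually.frequently (eventually_mem_nhdsWithin.mono fun z hz => ?_)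
    have h := hillDiscr_exp a 0 lam (-Complex.log z)
    rwa [neg_neg, Complex.exp_log hz, zero_mul] at h

lemma hillDiscr_zero_left (b lam : ℂ) : hillDiscr 0 b lam = hillDiscr 0 0 lam := by
  refine Eq.symm ?_
  have := eq_const_of_frequently (z₀ := 0) (c := hillDiscr 0 b lam)
    (f := fun z => hillDiscr 0 (b * z) lam)
    (differentiable_hillDiscr (by fun_prop) (by fun_prop) (by fun_prop)) ?_ 0
  · simpa using this
  · refine Filter.Eventually.frequently (eventually_mem_nhdsWithin.mono fun z hz => ?_)
    have h := hillDiscr_exp 0 b lam (Complex.log z)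
    rwa [Complex.exp_log hz, zero_mul] at h

lemma hillDiscr_of_mul_eq_zero {a b : ℂ} (h : a * b = 0) (lam : ℂ) :
    hillDiscr a b lam = hillDiscr 0 0 lam := by
  rcases mul_eq_zero.1 h with rfl | rfl
  · exact hillDiscr_zero_left b lam
  · exact hillDiscr_zero_right a lam

theorem hillDiscr_eq_of_mul_eq {a b c d : ℂ} (h : a * b = c * d) (lam : ℂ) :
    hillDiscr a b lam = hillDiscr c d lam := by
  by_cases h0 : a * b = 0
  · rw [hillDiscr_of_mul_eq_zero h0, hillDiscr_of_mul_eq_zero (h.symm.trans h0)]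
  · have hb : b ≠ 0 := right_ne_zero_of_mul h0
    have hd : d ≠ 0 := right_ne_zero_of_mul (h.symm.trans_ne h0)
    rw [← hillDiscr_exp a b lam (Complex.log (d / b)), Complex.exp_neg,
      Complex.exp_log (div_ne_zero hd hb)]
    congr 1
    · field_simp
      linear_combination h
    · field_simp

/-! ### Asymptotics of the discriminant -/

lemma norm_exp_mul_I_le (z : ℂ) : ‖Complex.exp (z * Complex.I)‖ ≤ Real.exp |z.im| := by
  rw [Complex.norm_exp]
  simpa using neg_le_abs z.im

lemma norm_cos_le_exp (z : ℂ) : ‖Complex.cos z‖ ≤ Real.exp |z.im| := by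
  have h1 := norm_exp_mul_I_le z
  have h2 := norm_exp_mul_I_le (-z)
  rw [Complex.neg_im, abs_neg] at h2
  rw [Complex.cos, norm_div, Complex.norm_ofNat]
  linarith [norm_add_le (Complex.exp (z * Complex.I)) (Complex.exp (-z * Complex.I))]

lemma norm_sin_le_exp (z : ℂ) : ‖Complex.sin z‖ ≤ Real.exp |z.im| := by
  have h1 := norm_exp_mul_I_le z
  have h2 := norm_exp_mul_I_le (-z)
  rw [Complex.neg_im, abs_neg] at h2
  rw [Complex.sin, norm_div, norm_mul, Complex.norm_I, Complex.norm_ofNat, mul_one]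
  linarith [norm_sub_le (Complex.exp (-z * Complex.I)) (Complex.exp (z * Complex.I))]

lemma abs_im_mul_ofReal (k : ℂ) {x : ℝ} (hx : 0 ≤ x) : |(k * x).im| = |k.im| * x := by
  simp [abs_mul, abs_of_nonneg hx]

namespace SolvesOn

variable {V : ℝ → ℂ} {k : ℂ} {L : ℝ} {y : ℝ → ℂ}

lemma eq_integral_sin (hV : Continuous V) (hy : SolvesOn (fun x => V x - k ^ 2) L y)
    (hk : k ≠ 0) {x : ℝ} (hx : x ∈ Icc (0 : ℝ) L) :
    y x = y 0 * Complex.cos (k * x) + deriv y 0 * Complex.sin (k * x) / k +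
      (∫ s in (0 : ℝ)..x, V s * y s * Complex.sin (k * ((x - s : ℝ) : ℂ))) / k := by
  have harg (s : ℝ) : HasDerivAt (fun s : ℝ => k * ((x - s : ℝ) : ℂ)) (-k) s := by
    simpa using (((hasDerivAt_id s).const_sub x).ofReal_comp).const_mul k
  have hsin (s : ℝ) := (Complex.hasDerivAt_sin _).comp s (harg s)
  have hcos (s : ℝ) := (Complex.hasDerivAt_cos _).comp s (harg s)
  have h := intervalIntegral.integral_eq_sub_of_hasDerivAt (a := 0) (b := x)
    (f := fun s => y s * Complex.cos (k * ((x - s : ℝ) : ℂ)) +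
      deriv y s * Complex.sin (k * ((x - s : ℝ) : ℂ)) / k)
    (f' := fun s => V s * y s * Complex.sin (k * ((x - s : ℝ) : ℂ)) / k)
    (fun s hs => by
      rw [uIcc_of_le hx.1] at hs
      refine (((hy.hasDerivAt s).mul (hcos s)).add
        (((hy.hasDerivAt_deriv s).mul (hsin s)).div_const k)).congr_deriv ?_
      rw [hy.2 s ⟨hs.1, hs.2.trans hx.2⟩]
      simp only [Function.comp_apply]
      field_simp
      ring)
    (by
      have := hy.1.continuous
      exact Continuous.intervalIntegrable (by fun_prop) _ _)
  rw [intervalIntegral.integral_div] at h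
  rw [h]
  simp

lemma deriv_eq_integral_cos (hV : Continuous V) (hy : SolvesOn (fun x => V x - k ^ 2) L y)
    {x : ℝ} (hx : x ∈ Icc (0 : ℝ) L) :
    deriv y x = deriv y 0 * Complex.cos (k * x) - k * y 0 * Complex.sin (k * x) +
      ∫ s in (0 : ℝ)..x, V s * y s * Complex.cos (k * ((x - s : ℝ) : ℂ)) := by
  have harg (s : ℝ) : HasDerivAt (fun s : ℝ => k * ((x - s : ℝ) : ℂ)) (-k) s := by
    simpa using (((hasDerivAt_id s).const_sub x).ofReal_comp).const_mul k
  have hsin (s : ℝ) := (Complex.hasDerivAt_sin _).comp s (harg s)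
  have hcos (s : ℝ) := (Complex.hasDerivAt_cos _).comp s (harg s)
  have h := intervalIntegral.integral_eq_sub_of_hasDerivAt (a := 0) (b := x)
    (f := fun s => deriv y s * Complex.cos (k * ((x - s : ℝ) : ℂ)) -
      k * y s * Complex.sin (k * ((x - s : ℝ) : ℂ)))
    (f' := fun s => V s * y s * Complex.cos (k * ((x - s : ℝ) : ℂ)))
    (fun s hs => by
      rw [uIcc_of_le hx.1] at hs
      refine (((hy.hasDerivAt_deriv s).mul (hcos s)).sub
        (((hy.hasDerivAt s).const_mul k).mul (hsin s))).congr_deriv ?_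
      rw [hy.2 s ⟨hs.1, hs.2.trans hx.2⟩]
      simp only [Function.comp_apply]
      ring)
    (by
      have := hy.1.continuous
      exact Continuous.intervalIntegrable (by fun_prop) _ _)
  rw [h]
  simp

/-- A bound for the integrals in the variation of constants formulas. -/
lemma norm_integral_le {R m : ℝ} (hR : ∀ x, ‖V x‖ ≤ R) {x : ℝ} (hx : x ∈ Icc (0 : ℝ) 1)
    (hm : ∀ s ∈ Icc (0 : ℝ) 1, ‖y s‖ ≤ m * Real.exp (|k.im| * s)) {g : ℂ → ℂ}
    (hg : ∀ z, ‖g z‖ ≤ Real.exp |z.im|) :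
    ‖∫ s in (0 : ℝ)..x, V s * y s * g (k * ((x - s : ℝ) : ℂ))‖ ≤
      R * m * Real.exp (|k.im| * x) := by
  have hR0 : 0 ≤ R := (norm_nonneg _).trans (hR 0)
  have hm0 : 0 ≤ m := by simpa using (norm_nonneg _).trans (hm 0 (by simp))
  have h := intervalIntegral.norm_integral_le_of_norm_le_const (a := 0) (b := x)
    (f := fun s => V s * y s * g (k * ((x - s : ℝ) : ℂ)))
    (C := R * m * Real.exp (|k.im| * x)) fun s hs => ?_
  · refine h.trans (mul_le_of_le_one_right (by positivity) ?_)
    rw [sub_zero, abs_of_nonneg hx.1]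
    exact hx.2
  · rw [uIoc_of_le hx.1] at hs
    have h1 := hg (k * ((x - s : ℝ) : ℂ))
    rw [abs_im_mul_ofReal _ (sub_nonneg.2 hs.2)] at h1
    rw [norm_mul, norm_mul]
    calc ‖V s‖ * ‖y s‖ * ‖g (k * ((x - s : ℝ) : ℂ))‖
        ≤ R * (m * Real.exp (|k.im| * s)) * Real.exp (|k.im| * (x - s)) := by
          gcongr
          · exact hR s
          · exact hm s ⟨hs.1.le, hs.2.trans hx.2⟩
      _ = R * m * Real.exp (|k.im| * x) := by
          rw [mul_assoc, mul_assoc, ← Real.exp_add, mul_assoc]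
          ring_nf

lemma norm_le_two_mul {R A : ℝ} (hV : Continuous V)
    (hy : SolvesOn (fun x => V x - k ^ 2) 1 y) (hk : k ≠ 0) (hR : ∀ x, ‖V x‖ ≤ R)
    (hRk : 2 * R ≤ ‖k‖) (hA : ‖y 0‖ + ‖deriv y 0‖ / ‖k‖ ≤ A) {x : ℝ}
    (hx : x ∈ Icc (0 : ℝ) 1) : ‖y x‖ ≤ 2 * A * Real.exp (|k.im| * x) := by
  have hk0 : 0 < ‖k‖ := norm_pos_iff.2 hk
  obtain ⟨x₀, hx₀, hmax⟩ := isCompact_Icc.exists_isMaxOn (s := Icc (0 : ℝ) 1)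
    (f := fun x => ‖y x‖ * Real.exp (-(|k.im| * x))) ⟨0, by simp⟩ (by
      have := hy.1.continuous
      exact Continuous.continuousOn (by fun_prop))
  set m := ‖y x₀‖ * Real.exp (-(|k.im| * x₀)) with hm
  have hyx (s : ℝ) (hs : s ∈ Icc (0 : ℝ) 1) : ‖y s‖ ≤ m * Real.exp (|k.im| * s) := by
    have : ‖y s‖ * Real.exp (-(|k.im| * s)) ≤ m := hmax hs
    rwa [Real.exp_neg, ← div_eq_mul_inv, div_le_iff₀ (Real.exp_pos _)] at this
  have hm0 : 0 ≤ m := by positivity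
  have hbound : ‖y x₀‖ ≤ (A + m / 2) * Real.exp (|k.im| * x₀) := by
    have hc := norm_cos_le_exp (k * x₀)
    have hs := norm_sin_le_exp (k * x₀)
    rw [abs_im_mul_ofReal _ hx₀.1] at hc hs
    have hi := norm_integral_le (V := V) hR hx₀ hyx norm_sin_le_exp
    rw [hy.eq_integral_sin hV hk hx₀]
    refine (norm_add₃_le).trans ?_
    rw [norm_div, norm_div, norm_mul, norm_mul]
    calc _ ≤ ‖y 0‖ * Real.exp (|k.im| * x₀) +
          ‖deriv y 0‖ * Real.exp (|k.im| * x₀) / ‖k‖ +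
          R * m * Real.exp (|k.im| * x₀) / ‖k‖ := by gcongr
      _ = (‖y 0‖ + ‖deriv y 0‖ / ‖k‖ + m * (R / ‖k‖)) * Real.exp (|k.im| * x₀) := by ring
      _ ≤ (A + m * (1 / 2)) * Real.exp (|k.im| * x₀) := by
          have : R / ‖k‖ ≤ 1 / 2 := by
            rw [div_le_iff₀ hk0]
            linarith
          gcongr
      _ = _ := by ring
  have hmA : m ≤ A + m / 2 := by
    calc m ≤ (A + m / 2) * Real.exp (|k.im| * x₀) * Real.exp (-(|k.im| * x₀)) := by
          rw [hm]
          gcongr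
      _ = A + m / 2 := by rw [mul_assoc, ← Real.exp_add]; simp
  refine (hyx x hx).trans ?_
  gcongr
  linarith

end SolvesOn

lemma norm_mathieuPot_le (a b : ℂ) (x : ℝ) : ‖mathieuPot a b x‖ ≤ ‖a‖ + ‖b‖ := by
  refine (norm_add_le _ _).trans_eq ?_
  simp [Complex.norm_exp]

lemma norm_hillDiscr_sq_sub_le (a b : ℂ) {k : ℂ} (hk : k ≠ 0) (hR : 2 * (‖a‖ + ‖b‖) ≤ ‖k‖) :
    ‖hillDiscr a b (k ^ 2) - 2 * Complex.cos k‖ ≤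
      4 * (‖a‖ + ‖b‖) / ‖k‖ * Real.exp |k.im| := by
  have hk0 : 0 < ‖k‖ := norm_pos_iff.2 hk
  have h01 : (1 : ℝ) ∈ Icc (0 : ℝ) 1 := by simp
  have hV := continuous_mathieuPot a b
  have hu := (solvesOn_ivpExt a b (k ^ 2) 1 0).mono one_le_two
  have hv := (solvesOn_ivpExt a b (k ^ 2) 0 1).mono one_le_two
  have hD : hillDiscr a b (k ^ 2) = ivpExt (mathieuCoeff a b (k ^ 2)) 1 0 1
      + deriv (ivpExt (mathieuCoeff a b (k ^ 2)) 0 1) 1 := by rw [deriv_ivpExt]; rfl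
  have hu0 : ivpExt (mathieuCoeff a b (k ^ 2)) 1 0 0 = 1 := ivpExt_zero _ _ _
  have hv0 : ivpExt (mathieuCoeff a b (k ^ 2)) 0 1 0 = 0 := ivpExt_zero _ _ _
  have hu1 : deriv (ivpExt (mathieuCoeff a b (k ^ 2)) 1 0) 0 = 0 := by
    rw [deriv_ivpExt, ivpDeriv_zero]
  have hv1 : deriv (ivpExt (mathieuCoeff a b (k ^ 2)) 0 1) 0 = 1 := by
    rw [deriv_ivpExt, ivpDeriv_zero]
  rw [hD]
  generalize ivpExt (mathieuCoeff a b (k ^ 2)) 1 0 = u at *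
  generalize ivpExt (mathieuCoeff a b (k ^ 2)) 0 1 = v at *
  have hub (s : ℝ) (hs : s ∈ Icc (0 : ℝ) 1) : ‖u s‖ ≤ 2 * 1 * Real.exp (|k.im| * s) :=
    hu.norm_le_two_mul hV hk (norm_mathieuPot_le a b) hR (by simp [hu0, hu1]) hs
  have hvb (s : ℝ) (hs : s ∈ Icc (0 : ℝ) 1) :
      ‖v s‖ ≤ 2 * (1 / ‖k‖) * Real.exp (|k.im| * s) :=
    hv.norm_le_two_mul hV hk (norm_mathieuPot_le a b) hR (by simp [hv0, hv1]) hs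
  have hui := SolvesOn.norm_integral_le (norm_mathieuPot_le a b) h01 hub norm_sin_le_exp
  have hvi := SolvesOn.norm_integral_le (norm_mathieuPot_le a b) h01 hvb norm_cos_le_exp
  rw [hu.eq_integral_sin hV hk h01, hv.deriv_eq_integral_cos hV h01, hu0, hu1, hv0, hv1]
  generalize (∫ s in (0 : ℝ)..1, mathieuPot a b s * u s *
    Complex.sin (k * ((1 - s : ℝ) : ℂ))) = I₁ at *
  generalize (∫ s in (0 : ℝ)..1, mathieuPot a b s * v s *
    Complex.cos (k * ((1 - s : ℝ) : ℂ))) = I₂ at *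
  rw [mul_one |k.im|] at hui hvi
  calc _ = ‖I₁ / k + I₂‖ := by
        congr 1
        push_cast
        ring_nf
    _ ≤ ‖I₁‖ / ‖k‖ + ‖I₂‖ := (norm_add_le _ _).trans_eq (by rw [norm_div])
    _ ≤ (‖a‖ + ‖b‖) * (2 * 1) * Real.exp |k.im| / ‖k‖ +
        (‖a‖ + ‖b‖) * (2 * (1 / ‖k‖)) * Real.exp |k.im| := by gcongr
    _ = _ := by ring

/-! ### Existence of large eigenvalues -/

lemma exists_zero_of_norm_lt {f : ℂ → ℂ} (hf : Differentiable ℂ f) {r δ : ℝ} (hr : 0 < r)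
    (hsphere : ∀ w ∈ Metric.sphere (0 : ℂ) r, δ ≤ ‖f w‖) (h0 : ‖f 0‖ < δ) :
    ∃ w ∈ Metric.closedBall (0 : ℂ) r, f w = 0 := by
  by_contra! hne
  have hδ : 0 < δ := (norm_nonneg _).trans_lt h0
  have hd : DiffContOnCl ℂ (fun w => (f w)⁻¹) (Metric.ball 0 r) := by
    refine hf.diffContOnCl.inv fun w hw => hne w ?_
    rwa [closure_ball _ hr.ne'] at hw
  have h := Complex.norm_le_of_forall_mem_frontier_norm_le Metric.isBounded_ball hd
    (C := δ⁻¹) (fun w hw => ?_) (subset_closure (Metric.mem_ball_self hr))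
  · rw [norm_inv] at h
    have h00 : 0 < ‖f 0‖ := norm_pos_iff.2 (hne 0 (Metric.mem_closedBall_self hr.le))
    exact absurd ((inv_le_inv₀ h00 hδ).1 h) (not_le.2 h0)
  · rw [frontier_ball _ hr.ne'] at hw
    rw [norm_inv]
    exact inv_anti₀ hδ (hsphere w hw)

lemma exists_radius_cos (t : ℝ) : ∃ r > 0, r ≤ 1 ∧ ∃ δ > 0, ∀ w ∈ Metric.sphere (0 : ℂ) r,
    δ ≤ ‖2 * Complex.cos (t + w) - 2 * Complex.cos t‖ := by
  have hf : Differentiable ℂ fun w => 2 * Complex.cos (t + w) - 2 * Complex.cos t := by fun_prop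
  rcases (hf.analyticAt 0).eventually_eq_zero_or_eventually_ne_zero with h | h
  · have h0 := eq_const_of_frequently (z₀ := 0) hf
      (h.filter_mono nhdsWithin_le_nhds).frequently
    have h1 := h0 (-t)
    have h2 := h0 (Real.pi - t)
    simp only [add_neg_cancel, add_sub_cancel, Complex.cos_zero, Complex.cos_pi] at h1 h2
    exact absurd (by linear_combination (h1 - h2) / 4 : (1 : ℂ) = 0) one_ne_zero
  · obtain ⟨ε, hε, hball⟩ := Metric.mem_nhdsWithin_iff.1 h
    have hr : 0 < min (ε / 2) 1 := by positivity
    refine ⟨min (ε / 2) 1, hr, min_le_right _ _, ?_⟩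
    obtain ⟨w₀, hw₀, hmin⟩ := (isCompact_sphere (0 : ℂ) (min (ε / 2) 1)).exists_isMinOn
      (NormedSpace.sphere_nonempty.2 hr.le) hf.continuous.norm.continuousOn
    refine ⟨_, norm_pos_iff.2 (hball ⟨?_, ?_⟩), fun w hw => hmin hw⟩
    · rw [mem_sphere_zero_iff_norm] at hw₀
      rw [mem_ball_zero_iff, hw₀]
      linarith [min_le_left (ε / 2) 1]
    · rintro rfl
      simp at hw₀
      linarith

lemma exists_isEigenvalueH_norm_ge (a b : ℂ) (t B : ℝ) :
    ∃ lam, IsEigenvalueH a b t lam ∧ B ≤ ‖lam‖ := by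
  obtain ⟨r, hr, hr1, δ, hδ, hsphere⟩ := exists_radius_cos t
  set R := ‖a‖ + ‖b‖ with hR
  have hR0 : 0 ≤ R := by positivity
  set K := max (max (2 * R + 2) (B + 2)) (16 * R * Real.exp 1 / δ + 2) - t with hK
  obtain ⟨n, hn⟩ := exists_nat_ge (K / (2 * Real.pi))
  rw [div_le_iff₀ (by positivity), hK, sub_le_iff_le_add, max_le_iff, max_le_iff] at hn
  set κ : ℝ := n * (2 * Real.pi) + t with hκ
  obtain ⟨⟨hκ1, hκ2⟩, hκ3⟩ := hn
  have hnorm {w : ℂ} (hw : w ∈ Metric.closedBall (0 : ℂ) r) : κ - 1 ≤ ‖(κ : ℂ) + w‖ := by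
    rw [mem_closedBall_zero_iff] at hw
    have h1 := norm_sub_le ((κ : ℂ) + w) w
    rw [add_sub_cancel_right, Complex.norm_real, Real.norm_eq_abs] at h1
    linarith [le_abs_self κ]
  have hcos (w : ℂ) : Complex.cos (κ + w) = Complex.cos (t + w) := by
    rw [hκ]
    push_cast
    rw [add_assoc, add_comm, Complex.cos_add_nat_mul_two_pi]
  have hclose {w : ℂ} (hw : w ∈ Metric.closedBall (0 : ℂ) r) :
      ‖hillDiscr a b ((κ + w) ^ 2) - 2 * Complex.cos (t + w)‖ < δ / 2 := by
    have hw' := hnorm hw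
    have hpos : 0 < ‖(κ : ℂ) + w‖ := by linarith
    rw [← hcos]
    refine (norm_hillDiscr_sq_sub_le a b (norm_pos_iff.1 hpos) (by linarith)).trans_lt ?_
    rw [← hR]
    have him : |((κ : ℂ) + w).im| ≤ 1 := by
      rw [Complex.add_im, Complex.ofReal_im, zero_add]
      exact (Complex.abs_im_le_norm w).trans ((mem_closedBall_zero_iff.1 hw).trans hr1)
    have h16 : 16 * R * Real.exp 1 / δ < ‖(κ : ℂ) + w‖ := by linarith
    rw [div_lt_iff₀ hδ] at h16
    calc 4 * R / ‖(κ : ℂ) + w‖ * Real.exp |((κ : ℂ) + w).im|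
        ≤ 4 * R / ‖(κ : ℂ) + w‖ * Real.exp 1 := by gcongr
      _ < δ / 2 := by
        rw [div_mul_eq_mul_div, div_lt_iff₀ hpos]
        have := mul_nonneg hR0 (Real.exp_pos 1).le
        nlinarith [mul_pos hpos hδ]
  have hdiff : Differentiable ℂ fun w : ℂ => hillDiscr a b ((κ + w) ^ 2) - 2 * Complex.cos t :=
    (differentiable_hillDiscr (differentiable_const a) (differentiable_const b)
      (by fun_prop)).sub_const _
  have hge : ∀ w ∈ Metric.sphere (0 : ℂ) r,
      δ / 2 ≤ ‖hillDiscr a b ((κ + w) ^ 2) - 2 * Complex.cos t‖ := fun w hw => by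
    have h1 := hclose (Metric.sphere_subset_closedBall hw)
    have h2 := norm_sub_le_norm_sub_add_norm_sub (2 * Complex.cos (t + w))
      (hillDiscr a b ((κ + w) ^ 2)) (2 * Complex.cos t)
    rw [norm_sub_rev (2 * Complex.cos (t + w)) (hillDiscr a b ((κ + w) ^ 2))] at h2
    linarith [hsphere w hw]
  obtain ⟨w, hw, hw0⟩ := exists_zero_of_norm_lt hdiff hr hge
    (by simpa using hclose (Metric.mem_closedBall_self hr.le))
  refine ⟨(κ + w) ^ 2, (isEigenvalueH_iff _ _ _ _).2 (sub_eq_zero.1 hw0), ?_⟩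
  have := hnorm hw
  rw [norm_pow]
  nlinarith

/-! ### Fourier coefficients of eigenfunctions -/

/-- The Fourier coefficient of `y` on `[0, 1]` at the frequency `2 π n + t`. -/
noncomputable def quasiCoeff (t : ℝ) (y : ℝ → ℂ) (n : ℤ) : ℂ :=
  ∫ x in (0 : ℝ)..1, Complex.exp (-(Complex.I * (2 * Real.pi * n + t)) * x) * y x

lemma fourierCoeffOn_eq_quasiCoeff (t : ℝ) (y : ℝ → ℂ) (n : ℤ) :
    fourierCoeffOn zero_lt_one (fun x => Complex.exp (-(Complex.I * t) * x) * y x) n =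
      quasiCoeff t y n := by
  rw [fourierCoeffOn_eq_integral, quasiCoeff, sub_zero, div_one, one_smul]
  refine intervalIntegral.integral_congr fun x _ => ?_
  simp only [smul_eq_mul]
  rw [fourier_coe_apply, ← mul_assoc, ← Complex.exp_add]
  congr 2
  push_cast
  ring

lemma hasSum_sq_quasiCoeff (t : ℝ) {y : ℝ → ℂ} (hy : Continuous y) :
    HasSum (fun n => ‖quasiCoeff t y n‖ ^ 2) (∫ x in (0 : ℝ)..1, ‖y x‖ ^ 2) := by
  have hg : Continuous fun x : ℝ => Complex.exp (-(Complex.I * t) * x) * y x := by fun_prop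
  have hL : MeasureTheory.MemLp (fun x : ℝ => Complex.exp (-(Complex.I * t) * x) * y x) 2
      (MeasureTheory.volume.restrict (Ioc 0 1)) := by
    obtain ⟨C, hC⟩ := isCompact_Icc.exists_bound_of_continuousOn (s := Icc (0 : ℝ) 1)
      hg.continuousOn
    refine MeasureTheory.MemLp.of_bound hg.aestronglyMeasurable C ?_
    filter_upwards [MeasureTheory.ae_restrict_mem measurableSet_Ioc] with x hx
    exact hC x (Ioc_subset_Icc_self hx)
  have h := hasSum_sq_fourierCoeffOn zero_lt_one hL
  simp only [fourierCoeffOn_eq_quasiCoeff, sub_zero, inv_one, one_smul, norm_mul] at h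
  convert h using 3 with x
  rw [Complex.norm_exp]
  simp

lemma exists_quasiCoeff_ne_zero (t : ℝ) {y : ℝ → ℂ} (hy : Continuous y)
    (hne : ¬ ∀ x ∈ Icc (0 : ℝ) 1, y x = 0) : ∃ n, quasiCoeff t y n ≠ 0 := by
  by_contra! h0
  have h := hasSum_sq_quasiCoeff t hy
  simp only [h0, norm_zero, ne_eq, OfNat.ofNat_ne_zero, not_false_eq_true, zero_pow] at h
  push Not at hne
  obtain ⟨x, hx, hyx⟩ := hne
  have hpos : 0 < ∫ x in (0 : ℝ)..1, ‖y x‖ ^ 2 :=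
    intervalIntegral.integral_pos zero_lt_one (by fun_prop) (fun _ _ => by positivity)
      ⟨x, hx, by positivity⟩
  exact hpos.ne (hasSum_zero.unique h)

lemma exists_max_quasiCoeff (t : ℝ) {y : ℝ → ℂ} (hy : Continuous y)
    (hne : ¬ ∀ x ∈ Icc (0 : ℝ) 1, y x = 0) :
    ∃ n, quasiCoeff t y n ≠ 0 ∧ ∀ m, ‖quasiCoeff t y m‖ ≤ ‖quasiCoeff t y n‖ := by
  obtain ⟨n₀, hn₀⟩ := exists_quasiCoeff_ne_zero t hy hne
  have hfin : {n | ‖quasiCoeff t y n₀‖ ^ 2 ≤ ‖quasiCoeff t y n‖ ^ 2}.Finite := by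
    have h := (hasSum_sq_quasiCoeff t hy).summable.tendsto_cofinite_zero.eventually_lt_const
      (show 0 < ‖quasiCoeff t y n₀‖ ^ 2 by positivity)
    simpa only [not_lt] using Filter.eventually_cofinite.1 h
  obtain ⟨n, hn, hmax⟩ := Set.exists_max_image _ (fun n => ‖quasiCoeff t y n‖) hfin
    ⟨n₀, le_refl (‖quasiCoeff t y n₀‖ ^ 2)⟩
  refine ⟨n, fun h => ?_, fun m => ?_⟩
  · rw [mem_ofPred_eq, h] at hn
    have : 0 < ‖quasiCoeff t y n₀‖ ^ 2 := by positivity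
    norm_num at hn
    exact hn₀ hn
  · rcases le_total (‖quasiCoeff t y n₀‖) (‖quasiCoeff t y m‖) with h | h
    · exact hmax m (pow_le_pow_left₀ (norm_nonneg _) h 2)
    · exact h.trans (le_of_sq_le_sq hn (norm_nonneg _))

lemma quasiCoeff_recurrence {a b lam : ℂ} {t : ℝ} {y : ℝ → ℂ}
    (hy : SolvesOn (fun x => mathieuPot a b x - lam) 1 y)
    (h0 : y 1 = Complex.exp (Complex.I * t) * y 0)
    (h1 : deriv y 1 = Complex.exp (Complex.I * t) * deriv y 0) (n : ℤ) :
    (lam - (2 * Real.pi * n + t) ^ 2) * quasiCoeff t y n =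
      a * quasiCoeff t y (n + 1) + b * quasiCoeff t y (n - 1) := by
  set k : ℂ := 2 * Real.pi * n + t with hk
  have hcy := hy.1.continuous
  have h_int (m : ℤ) : IntervalIntegrable
      (fun x : ℝ => Complex.exp (-(Complex.I * (2 * Real.pi * m + t)) * x) * y x)
      MeasureTheory.volume 0 1 := by
    apply Continuous.intervalIntegrable
    fun_prop
  have he (x : ℝ) : HasDerivAt (fun x : ℝ => Complex.exp (-(Complex.I * k) * x))
      (-(Complex.I * k) * Complex.exp (-(Complex.I * k) * x)) x := by
    have := ((Complex.ofRealCLM.hasDerivAt (x := x)).const_mul (-(Complex.I * k))).cexp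
    simpa [mul_comm] using this
  have hd (x : ℝ) := (he x).mul
    ((hy.hasDerivAt_deriv x).add ((hy.hasDerivAt x).const_mul (Complex.I * k)))
  have hFTC := intervalIntegral.integral_eq_sub_of_hasDerivAt (a := 0) (b := 1)
    (fun x _ => hd x) (by
      apply Continuous.intervalIntegrable
      have h2 := hy.continuous_deriv_deriv
      have h3 := hy.contDiff_deriv.continuous
      fun_prop)
  have hρ : Complex.exp (-(Complex.I * k)) * Complex.exp (Complex.I * t) = 1 := by
    rw [← Complex.exp_add, Complex.exp_eq_one_iff]
    refine ⟨-n, ?_⟩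
    rw [hk]
    push_cast
    ring
  have hbd : Complex.exp (-(Complex.I * k) * (1 : ℝ)) * (deriv y 1 + Complex.I * k * y 1)
      - Complex.exp (-(Complex.I * k) * (0 : ℝ)) * (deriv y 0 + Complex.I * k * y 0) = 0 := by
    rw [h0, h1]
    simp only [Complex.ofReal_one, mul_one, Complex.ofReal_zero, mul_zero, Complex.exp_zero]
    linear_combination (deriv y 0 + Complex.I * k * y 0) * hρ
  have hsum : ∫ x in (0 : ℝ)..1,
      (a * (Complex.exp (-(Complex.I * (2 * Real.pi * (n + 1 : ℤ) + t)) * x) * y x)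
        + b * (Complex.exp (-(Complex.I * (2 * Real.pi * (n - 1 : ℤ) + t)) * x) * y x)
        - (lam - k ^ 2) * (Complex.exp (-(Complex.I * k) * x) * y x)) = 0 := by
    rw [← hbd]
    refine Eq.trans (intervalIntegral.integral_congr fun x hx => ?_) hFTC
    rw [uIcc_of_le zero_le_one] at hx
    have hV : a * Complex.exp (-(Complex.I * (2 * Real.pi * (n + 1 : ℤ) + t)) * x)
        + b * Complex.exp (-(Complex.I * (2 * Real.pi * (n - 1 : ℤ) + t)) * x)
        = Complex.exp (-(Complex.I * k) * x) * mathieuPot a b x := by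
      have hV1 : Complex.exp (-(Complex.I * (2 * Real.pi * (n + 1 : ℤ) + t)) * x) =
          Complex.exp (-(Complex.I * k) * x) * Complex.exp (-(2 * Real.pi * Complex.I) * x) := by
        rw [← Complex.exp_add, hk]
        push_cast
        ring_nf
      have hV2 : Complex.exp (-(Complex.I * (2 * Real.pi * (n - 1 : ℤ) + t)) * x) =
          Complex.exp (-(Complex.I * k) * x) * Complex.exp (2 * Real.pi * Complex.I * x) := by
        rw [← Complex.exp_add, hk]
        push_cast
        ring_nf
      rw [mathieuPot, hV1, hV2]
      ring
    simp only [Pi.add_apply, hy.2 x hx]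
    linear_combination y x * hV + k ^ 2 * Complex.exp (-(Complex.I * k) * x) * y x * Complex.I_sq
  rw [intervalIntegral.integral_sub (((h_int _).const_mul _).add ((h_int _).const_mul _))
      ((h_int n).const_mul _),
    intervalIntegral.integral_add ((h_int _).const_mul _) ((h_int _).const_mul _),
    intervalIntegral.integral_const_mul, intervalIntegral.integral_const_mul,
    intervalIntegral.integral_const_mul] at hsum
  exact (sub_eq_zero.1 hsum).symm

/-! ### Eigenvalue asymptotics at a fixed quasi-momentum -/

lemma norm_le_of_mul_eq_combination {a b D x y z : ℂ} {K m : ℝ} (hK : 0 < K) (hD : K ≤ ‖D‖)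
    (h : D * x = a * y + b * z) (hy : ‖y‖ ≤ m) (hz : ‖z‖ ≤ m) :
    ‖x‖ ≤ (‖a‖ + ‖b‖) * m / K := by
  rw [le_div_iff₀ hK]
  calc ‖x‖ * K ≤ ‖x‖ * ‖D‖ := by gcongr
    _ = ‖a * y + b * z‖ := by rw [← h, norm_mul, mul_comm]
    _ ≤ ‖a‖ * m + ‖b‖ * m := by
      refine (norm_add_le _ _).trans ?_
      rw [norm_mul, norm_mul]
      gcongr
    _ = (‖a‖ + ‖b‖) * m := by ring

lemma le_norm_sub_shifted_sq {lam : ℂ} {k R : ℝ} (hlam : ‖lam - k ^ 2‖ ≤ R)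
    (hk : 40 + R ≤ |k|) (j : ℤ) (hj1 : 1 ≤ |j|) (hj3 : |j| ≤ 3) :
    |k| ≤ ‖lam - (k + 2 * Real.pi * j) ^ 2‖ := by
  have hR : 0 ≤ R := (norm_nonneg _).trans hlam
  have h1 : (1 : ℝ) ≤ |(j : ℝ)| := by exact_mod_cast hj1
  have h3 : |(j : ℝ)| ≤ 3 := by exact_mod_cast hj3
  have hpi := Real.pi_gt_three
  have hpi' := Real.pi_lt_d2
  have h2 : ‖((k + 2 * Real.pi * j) ^ 2 - k ^ 2 : ℂ)‖
      = 4 * Real.pi * |(j : ℝ)| * |k + Real.pi * j| := by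
    rw [show ((k + 2 * Real.pi * j) ^ 2 - k ^ 2 : ℂ)
        = ((4 * Real.pi * j * (k + Real.pi * j) : ℝ) : ℂ) by push_cast; ring,
      Complex.norm_real, Real.norm_eq_abs, abs_mul, abs_mul, abs_of_pos (by positivity)]
  have h4 : |k| - 10 ≤ |k + Real.pi * j| := by
    have h5 := abs_sub (k + Real.pi * j) (Real.pi * j)
    rw [add_sub_cancel_right, abs_mul, abs_of_pos Real.pi_pos] at h5
    nlinarith
  have h5 := norm_sub_norm_le ((k + 2 * Real.pi * j) ^ 2 - k ^ 2 : ℂ) (lam - k ^ 2)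
  rw [sub_sub_sub_cancel_right, h2, norm_sub_rev _ lam] at h5
  have h6 : 12 * (|k| - 10) ≤ 4 * Real.pi * |(j : ℝ)| * |k + Real.pi * j| := by
    refine mul_le_mul ?_ h4 (by linarith) (by positivity)
    nlinarith
  linarith

lemma norm_sq_mul_sum_inv_sub_half_le {δ : ℂ} {k R : ℝ} (hk : 1 ≤ |k|)
    (hδ : ‖δ‖ ≤ R) (hδk : ‖δ‖ * |k| ≤ R ^ 2) {D₁ D₂ : ℂ}
    (hD₁ : D₁ = δ - 4 * Real.pi * k - 4 * Real.pi ^ 2)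
    (hD₂ : D₂ = δ + 4 * Real.pi * k - 4 * Real.pi ^ 2)
    (h₁ : |k| ≤ ‖D₁‖) (h₂ : |k| ≤ ‖D₂‖) :
    ‖(k : ℂ) ^ 2 * (D₁⁻¹ + D₂⁻¹) - 1 / 2‖ ≤ (4 * R ^ 2 + (R + 40) ^ 2) / 2 / |k| := by
  have hk0 : 0 < |k| := by linarith
  have hn₁ : D₁ ≠ 0 := norm_pos_iff.1 (hk0.trans_le h₁)
  have hn₂ : D₂ ≠ 0 := norm_pos_iff.1 (hk0.trans_le h₂)
  have hid : (k : ℂ) ^ 2 * (D₁⁻¹ + D₂⁻¹) - 1 / 2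
      = (4 * k ^ 2 * δ - (δ - 4 * Real.pi ^ 2) ^ 2) / (2 * (D₁ * D₂)) := by
    field_simp
    rw [hD₁, hD₂]
    ring
  have hn₁' : 0 < ‖D₁‖ := norm_pos_iff.2 hn₁
  have hn₂' : 0 < ‖D₂‖ := norm_pos_iff.2 hn₂
  rw [hid, norm_div, norm_mul, norm_mul D₁, Complex.norm_ofNat, div_div,
    div_le_div_iff₀ (by positivity) (mul_pos two_pos hk0)]
  have hR : 0 ≤ R := (norm_nonneg _).trans hδ
  have hnum : ‖(4 * k ^ 2 * δ - (δ - 4 * Real.pi ^ 2) ^ 2 : ℂ)‖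
      ≤ (4 * R ^ 2 + (R + 40) ^ 2) * |k| := by
    have h3 : ‖(4 * k ^ 2 * δ : ℂ)‖ ≤ 4 * R ^ 2 * |k| := by
      rw [norm_mul, norm_mul, norm_pow, Complex.norm_real, Complex.norm_ofNat, Real.norm_eq_abs]
      nlinarith
    have h4 : ‖(δ - 4 * Real.pi ^ 2 : ℂ)‖ ≤ R + 40 := by
      refine (norm_sub_le _ _).trans (add_le_add hδ ?_)
      rw [norm_mul, norm_pow, Complex.norm_real, Complex.norm_ofNat, Real.norm_eq_abs,
        abs_of_pos Real.pi_pos]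
      nlinarith [Real.pi_lt_d2, Real.pi_pos]
    refine (norm_sub_le _ _).trans ?_
    rw [add_mul]
    refine add_le_add h3 ?_
    rw [norm_pow]
    have := pow_le_pow_left₀ (norm_nonneg _) h4 2
    nlinarith [sq_nonneg (R + 40)]
  calc _ ≤ (4 * R ^ 2 + (R + 40) ^ 2) * |k| * (2 * |k|) := by gcongr
    _ = (4 * R ^ 2 + (R + 40) ^ 2) * (2 * (|k| * |k|)) := by ring
    _ ≤ _ := by gcongr

lemma norm_shift_le_of_recurrence {a b lam : ℂ} {k : ℝ} {d : ℤ → ℂ}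
    (hrec : ∀ j, (lam - (k + 2 * Real.pi * j) ^ 2) * d j = a * d (j + 1) + b * d (j - 1))
    (h0 : d 0 ≠ 0) (hmax : ∀ j, ‖d j‖ ≤ ‖d 0‖) : ‖lam - k ^ 2‖ ≤ ‖a‖ + ‖b‖ := by
  have hM : 0 < ‖d 0‖ := norm_pos_iff.2 h0
  have h := hrec 0
  simp only [Int.cast_zero, mul_zero, add_zero] at h
  refine le_of_mul_le_mul_right ?_ hM
  rw [← norm_mul, h, add_mul]
  refine (norm_add_le _ _).trans ?_
  rw [norm_mul, norm_mul]
  gcongr <;> exact hmax _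

lemma norm_sq_mul_shift_sub_half_le {a b lam : ℂ} {k : ℝ} {d : ℤ → ℂ}
    (hrec : ∀ j, (lam - (k + 2 * Real.pi * j) ^ 2) * d j = a * d (j + 1) + b * d (j - 1))
    (h0 : d 0 ≠ 0) (hmax : ∀ j, ‖d j‖ ≤ ‖d 0‖) (hk : 40 + (‖a‖ + ‖b‖) ≤ |k|) :
    ‖(k : ℂ) ^ 2 * (lam - k ^ 2) - a * b / 2‖ ≤
      ((‖a‖ + ‖b‖) ^ 4 + (‖a‖ + ‖b‖) ^ 2 *
        ((4 * (‖a‖ + ‖b‖) ^ 2 + (‖a‖ + ‖b‖ + 40) ^ 2) / 2)) / |k| := by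
  have hM : 0 < ‖d 0‖ := norm_pos_iff.2 h0
  have hδ := norm_shift_le_of_recurrence hrec h0 hmax
  have hR0 : 0 ≤ ‖a‖ + ‖b‖ := by positivity
  have haR : ‖a‖ ≤ ‖a‖ + ‖b‖ := le_add_of_nonneg_right (norm_nonneg b)
  have hbR : ‖b‖ ≤ ‖a‖ + ‖b‖ := le_add_of_nonneg_left (norm_nonneg a)
  have hk0 : 0 < |k| := by linarith
  have hD := le_norm_sub_shifted_sq hδ hk
  have first (j : ℤ) (h1 : 1 ≤ |j|) (h3 : |j| ≤ 3) :
      ‖d j‖ ≤ (‖a‖ + ‖b‖) * ‖d 0‖ / |k| :=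
    norm_le_of_mul_eq_combination hk0 (hD j h1 h3) (hrec j) (hmax _) (hmax _)
  have hp2 : ‖d 2‖ ≤ (‖a‖ + ‖b‖) * ((‖a‖ + ‖b‖) * ‖d 0‖ / |k|) / |k| :=
    norm_le_of_mul_eq_combination hk0 (hD 2 (by norm_num) (by norm_num)) (hrec 2)
      (first 3 (by norm_num) (by norm_num)) (first 1 (by norm_num) (by norm_num))
  have hm2 : ‖d (-2)‖ ≤ (‖a‖ + ‖b‖) * ((‖a‖ + ‖b‖) * ‖d 0‖ / |k|) / |k| :=
    norm_le_of_mul_eq_combination hk0 (hD (-2) (by norm_num) (by norm_num)) (hrec (-2))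
      (first (-2 + 1) (by norm_num) (by norm_num)) (first (-2 - 1) (by norm_num) (by norm_num))
  have hr0 := hrec 0
  have hr1 := hrec 1
  have hrm := hrec (-1)
  have hD1 := hD 1 (by norm_num) (by norm_num)
  have hDm := hD (-1) (by norm_num) (by norm_num)
  norm_num at hr0 hr1 hrm hD1 hDm
  set R := ‖a‖ + ‖b‖ with hR
  set δ : ℂ := lam - k ^ 2 with hδdef
  set D₁ : ℂ := lam - (k + 2 * Real.pi) ^ 2 with hD₁
  set D₂ : ℂ := lam - (k + -(2 * Real.pi)) ^ 2 with hD₂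
  have hn₁ : D₁ ≠ 0 := norm_pos_iff.1 (hk0.trans_le hD1)
  have hn₂ : D₂ ≠ 0 := norm_pos_iff.1 (hk0.trans_le hDm)
  have hδk : ‖δ‖ * |k| ≤ R ^ 2 := by
    have h1 := first 1 (by norm_num) (by norm_num)
    have h2 := first (-1) (by norm_num) (by norm_num)
    have h3 : ‖δ‖ * ‖d 0‖ ≤ R * (R * ‖d 0‖ / |k|) := by
      rw [← norm_mul, hr0, hR, add_mul]
      refine (norm_add_le _ _).trans ?_
      rw [norm_mul, norm_mul]
      gcongr
    refine le_of_mul_le_mul_right ?_ hM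
    calc ‖δ‖ * |k| * ‖d 0‖ = ‖δ‖ * ‖d 0‖ * |k| := by ring
      _ ≤ R * (R * ‖d 0‖ / |k|) * |k| := by gcongr
      _ = R ^ 2 * ‖d 0‖ := by field_simp
  have hsum := norm_sq_mul_sum_inv_sub_half_le (by linarith) hδ hδk (D₁ := D₁) (D₂ := D₂)
    (by rw [hD₁, hδdef]; ring) (by rw [hD₂, hδdef]; ring) hD1 hDm
  have hrem : (δ - a * b * (D₁⁻¹ + D₂⁻¹)) * d 0 = a ^ 2 * d 2 * D₁⁻¹ + b ^ 2 * d (-2) * D₂⁻¹ := by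
    field_simp
    linear_combination D₁ * D₂ * hr0 + a * D₂ * hr1 + b * D₁ * hrm
  have hquad (e D x : ℂ) (he : ‖x‖ ≤ R * (R * ‖d 0‖ / |k|) / |k|) (hDk : |k| ≤ ‖D‖) :
      ‖e ^ 2 * x * D⁻¹‖ ≤ ‖e‖ ^ 2 * (R ^ 2 * ‖d 0‖ / |k| ^ 3) := by
    rw [norm_mul, norm_mul, norm_pow, norm_inv]
    calc ‖e‖ ^ 2 * ‖x‖ * ‖D‖⁻¹ ≤ ‖e‖ ^ 2 * (R * (R * ‖d 0‖ / |k|) / |k|) * |k|⁻¹ := by gcongr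
      _ = _ := by field_simp
  have hrem' : ‖δ - a * b * (D₁⁻¹ + D₂⁻¹)‖ ≤ R ^ 4 / |k| ^ 3 := by
    refine le_of_mul_le_mul_right ?_ hM
    rw [← norm_mul, hrem]
    refine (norm_add_le _ _).trans ((add_le_add (hquad a D₁ _ hp2 hD1)
      (hquad b D₂ _ hm2 hDm)).trans ?_)
    rw [← add_mul]
    have hab : ‖a‖ ^ 2 + ‖b‖ ^ 2 ≤ R ^ 2 := by
      rw [hR]
      nlinarith [mul_nonneg (norm_nonneg a) (norm_nonneg b)]
    calc (‖a‖ ^ 2 + ‖b‖ ^ 2) * (R ^ 2 * ‖d 0‖ / |k| ^ 3)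
        ≤ R ^ 2 * (R ^ 2 * ‖d 0‖ / |k| ^ 3) := by gcongr
      _ = _ := by ring
  have hsplit : (k : ℂ) ^ 2 * δ - a * b / 2 = (k : ℂ) ^ 2 * (δ - a * b * (D₁⁻¹ + D₂⁻¹))
      + a * b * ((k : ℂ) ^ 2 * (D₁⁻¹ + D₂⁻¹) - 1 / 2) := by ring
  rw [hsplit]
  refine (norm_add_le _ _).trans ?_
  rw [add_div]
  refine add_le_add ?_ ?_
  · rw [norm_mul, norm_pow, Complex.norm_real, Real.norm_eq_abs]
    calc |k| ^ 2 * ‖δ - a * b * (D₁⁻¹ + D₂⁻¹)‖ ≤ |k| ^ 2 * (R ^ 4 / |k| ^ 3) := by gcongr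
      _ = R ^ 4 / |k| := by field_simp
  · rw [norm_mul, norm_mul, mul_div_assoc]
    have hab : ‖a‖ * ‖b‖ ≤ R ^ 2 := by
      rw [sq]
      gcongr
    gcongr

lemma exists_eigenvalue_asymptotics (a b : ℂ) (t : ℝ) :
    ∃ C, ∀ lam, IsEigenvalueH a b t lam → ∃ n : ℤ,
      ‖lam - ((2 * Real.pi * n + t : ℝ) : ℂ) ^ 2‖ ≤ ‖a‖ + ‖b‖ ∧
      (40 + (‖a‖ + ‖b‖) ≤ |2 * Real.pi * n + t| →
        ‖((2 * Real.pi * n + t : ℝ) : ℂ) ^ 2 * (lam - ((2 * Real.pi * n + t : ℝ) : ℂ) ^ 2)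
          - a * b / 2‖ ≤ C / |2 * Real.pi * n + t|) := by
  refine ⟨(‖a‖ + ‖b‖) ^ 4 + (‖a‖ + ‖b‖) ^ 2 *
    ((4 * (‖a‖ + ‖b‖) ^ 2 + (‖a‖ + ‖b‖ + 40) ^ 2) / 2), fun lam ⟨y, hy, hne, hode, h0, h1⟩ => ?_⟩
  have hs : SolvesOn (fun x => mathieuPot a b x - lam) 1 y :=
    ⟨hy, fun x hx => by linear_combination -hode x hx⟩
  obtain ⟨n, hn, hmax⟩ := exists_max_quasiCoeff t hy.continuous hne
  have hrec (j : ℤ) : (lam - (((2 * Real.pi * n + t : ℝ) : ℂ) + 2 * Real.pi * j) ^ 2)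
      * quasiCoeff t y (n + j) = a * quasiCoeff t y (n + (j + 1))
        + b * quasiCoeff t y (n + (j - 1)) := by
    rw [← add_assoc, ← add_sub_assoc, ← quasiCoeff_recurrence hs h0 h1]
    push_cast
    ring
  have hn' : quasiCoeff t y (n + 0) ≠ 0 := by rwa [add_zero]
  have hmax' (j : ℤ) : ‖quasiCoeff t y (n + j)‖ ≤ ‖quasiCoeff t y (n + 0)‖ := by
    rw [add_zero]
    exact hmax _
  exact ⟨n, norm_shift_le_of_recurrence (d := fun j => quasiCoeff t y (n + j)) hrec hn' hmax',
    norm_sq_mul_shift_sub_half_le (d := fun j => quasiCoeff t y (n + j)) hrec hn' hmax'⟩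

lemma exists_pos_le_abs_or_eq_zero (t : ℝ) :
    ∃ ε > 0, ∀ j : ℤ, 2 * Real.pi * j + 2 * t = 0 ∨ ε ≤ |2 * Real.pi * j + 2 * t| := by
  by_cases h : ∃ j₀ : ℤ, 2 * Real.pi * j₀ + 2 * t = 0
  · obtain ⟨j₀, hj₀⟩ := h
    refine ⟨2 * Real.pi, by positivity, fun j => ?_⟩
    have heq : 2 * Real.pi * j + 2 * t = 2 * Real.pi * (j - j₀ : ℤ) := by
      push_cast
      linear_combination hj₀
    rcases eq_or_ne (j - j₀) 0 with h | h
    · left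
      rw [heq, h]
      simp
    · right
      rw [heq, abs_mul, abs_of_pos (by positivity : 0 < 2 * Real.pi)]
      have : (1 : ℝ) ≤ |((j - j₀ : ℤ) : ℝ)| := by exact_mod_cast Int.one_le_abs h
      exact le_mul_of_one_le_right (by positivity) this
  · push Not at h
    have hscale (j : ℤ) : 2 * Real.pi * j + 2 * t = 2 * Real.pi * (t / Real.pi - (-j : ℤ)) := by
      push_cast
      field_simp
      ring
    refine ⟨2 * Real.pi * |t / Real.pi - round (t / Real.pi)|, ?_, fun j => Or.inr ?_⟩
    · have := h (-round (t / Real.pi))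
      rw [hscale, neg_neg] at this
      have := abs_pos.2 (right_ne_zero_of_mul this)
      positivity
    · rw [hscale, abs_mul, abs_of_pos (by positivity : 0 < 2 * Real.pi)]
      refine mul_le_mul_of_nonneg_left ?_ (by positivity)
      exact round_le (t / Real.pi) (-j)

lemma exists_forall_sq_eq_of_abs_sub_le (t B : ℝ) : ∃ K : ℝ, ∀ n m : ℤ,
    K ≤ |2 * Real.pi * n + t| →
      |(2 * Real.pi * n + t) ^ 2 - (2 * Real.pi * m + t) ^ 2| ≤ B →
        (2 * Real.pi * n + t) ^ 2 = (2 * Real.pi * m + t) ^ 2 := by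
  obtain ⟨ε, hε, hsep⟩ := exists_pos_le_abs_or_eq_zero t
  refine ⟨(|B| + 1) / min ε 1, fun n m hK hB => ?_⟩
  have hμ : 0 < min ε 1 := by positivity
  rw [div_le_iff₀ hμ] at hK
  have hs := hsep (n + m)
  set s : ℝ := 2 * Real.pi * (n + m : ℤ) + 2 * t with hsdef
  set d : ℝ := 2 * Real.pi * (n - m : ℤ) with hddef
  have hfac : (2 * Real.pi * n + t) ^ 2 - (2 * Real.pi * m + t) ^ 2 = s * d := by
    rw [hsdef, hddef]
    push_cast
    ring
  have hd : d = 0 ∨ 1 ≤ |d| := by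
    rcases eq_or_ne (n - m) 0 with h | h
    · left
      rw [hddef, h]
      simp
    · right
      rw [hddef, abs_mul, abs_of_pos (by positivity : 0 < 2 * Real.pi)]
      have : (1 : ℝ) ≤ |((n - m : ℤ) : ℝ)| := by exact_mod_cast Int.one_le_abs h
      nlinarith [Real.pi_gt_three]
  rw [← sub_eq_zero, hfac]
  rcases hs with hs | hs
  · rw [hs, zero_mul]
  rcases hd with hd | hd
  · rw [hd, mul_zero]
  exfalso
  rw [hfac, abs_mul] at hB
  have hsum : 2 * |2 * Real.pi * n + t| ≤ |s| + |d| := by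
    rw [show 2 * |2 * Real.pi * n + t| = |s + d| by
      rw [hsdef, hddef, ← abs_two, ← abs_mul]
      push_cast
      ring_nf]
    exact abs_add_le _ _
  have hμε := min_le_left ε 1
  have hμ1 := min_le_right ε 1
  have hBle := le_abs_self B
  nlinarith [abs_nonneg s, abs_nonneg d,
    mul_nonneg (sub_nonneg.2 (hμε.trans hs)) (sub_nonneg.2 (hμ1.trans hd))]

lemma mul_eq_mul_of_isEigenvalueH_iff {a b c d : ℂ} {t : ℝ}
    (h : ∀ lam, IsEigenvalueH a b t lam ↔ IsEigenvalueH c d t lam) : a * b = c * d := by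
  obtain ⟨C₁, hC₁⟩ := exists_eigenvalue_asymptotics a b t
  obtain ⟨C₂, hC₂⟩ := exists_eigenvalue_asymptotics c d t
  set R₁ := ‖a‖ + ‖b‖ with hR₁
  set R₂ := ‖c‖ + ‖d‖ with hR₂
  have hR₁0 : 0 ≤ R₁ := by positivity
  have hR₂0 : 0 ≤ R₂ := by positivity
  obtain ⟨K, hK⟩ := exists_forall_sq_eq_of_abs_sub_le t (R₁ + R₂)
  by_contra hne
  have hpos : 0 < ‖a * b - c * d‖ := norm_pos_iff.2 (sub_ne_zero.2 hne)
  set M : ℝ := |K| + (40 + R₁ + R₂) + 2 * (|C₁| + |C₂| + 1) / ‖a * b - c * d‖ with hM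
  have hq : 0 < 2 * (|C₁| + |C₂| + 1) / ‖a * b - c * d‖ := by positivity
  have hM0 : 0 ≤ M := by positivity
  obtain ⟨lam, hlam, hbig⟩ := exists_isEigenvalueH_norm_ge a b t (M ^ 2 + R₁)
  obtain ⟨n, hn, hn'⟩ := hC₁ lam hlam
  obtain ⟨m, hm, hm'⟩ := hC₂ lam ((h lam).1 hlam)
  have hkM : M ≤ |2 * Real.pi * n + t| := by
    have h1 := norm_sub_norm_le lam (((2 * Real.pi * n + t : ℝ) : ℂ) ^ 2)
    rw [norm_pow, Complex.norm_real, Real.norm_eq_abs] at h1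
    exact le_of_sq_le_sq (by linarith) (abs_nonneg _)
  have hsq := hK n m (by linarith [le_abs_self K]) (by
    have h1 := norm_sub_le_norm_sub_add_norm_sub (((2 * Real.pi * n + t : ℝ) : ℂ) ^ 2) lam
      (((2 * Real.pi * m + t : ℝ) : ℂ) ^ 2)
    rw [norm_sub_rev _ lam, ← Complex.ofReal_pow, ← Complex.ofReal_pow, ← Complex.ofReal_sub,
      Complex.norm_real, Real.norm_eq_abs, Complex.ofReal_pow, Complex.ofReal_pow] at h1
    linarith)
  have habs : |2 * Real.pi * n + t| = |2 * Real.pi * m + t| := (sq_eq_sq_iff_abs_eq_abs _ _).1 hsq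
  have h1 := hn' (by linarith [abs_nonneg K])
  have h2 := hm' (by linarith [abs_nonneg K])
  rw [← Complex.ofReal_pow] at h1 h2
  rw [← hsq, ← habs] at h2
  set k := 2 * Real.pi * n + t
  have hk0 : 0 < |k| := by linarith [abs_nonneg K]
  have h3 : ‖a * b - c * d‖ / 2 ≤ C₁ / |k| + C₂ / |k| := by
    have h4 := (norm_sub_le _ _).trans (add_le_add h2 h1)
    rw [show ((k ^ 2 : ℝ) : ℂ) * (lam - (k ^ 2 : ℝ)) - c * d / 2 -
      (((k ^ 2 : ℝ) : ℂ) * (lam - (k ^ 2 : ℝ)) - a * b / 2) = (a * b - c * d) / 2 by ring,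
      norm_div, Complex.norm_ofNat] at h4
    linarith
  rw [← add_div, le_div_iff₀ hk0] at h3
  have h5 : 2 * (|C₁| + |C₂| + 1) / ‖a * b - c * d‖ ≤ |k| := by linarith [abs_nonneg K]
  rw [div_le_iff₀ hpos] at h5
  linarith [le_abs_self C₁, le_abs_self C₂]

/-! ### The inverse Joukowsky map off the segment `[-2, 2]` -/

/-- The real segment `[-2, 2]` in the complex plane. -/
def bandSet : Set ℂ := {w | w.im = 0 ∧ |w.re| ≤ 2}

lemma isClosed_bandSet : IsClosed bandSet :=
  (isClosed_eq Complex.continuous_im continuous_const).inter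
    (isClosed_le Complex.continuous_re.abs continuous_const)

lemma mem_bandSet_iff {w : ℂ} :
    w ∈ bandSet ↔ ∃ t ∈ Ioc (-Real.pi) Real.pi, w = 2 * Complex.cos (t : ℝ) := by
  constructor
  · rintro ⟨him, hre⟩
    obtain ⟨h1, h2⟩ := abs_le.1 hre
    refine ⟨Real.arccos (w.re / 2), ⟨?_, Real.arccos_le_pi _⟩, ?_⟩
    · linarith [Real.arccos_nonneg (w.re / 2), Real.pi_pos]
    · rw [← Complex.ofReal_cos, Real.cos_arccos (by linarith) (by linarith)]
      refine Complex.ext ?_ (by simp [him])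
      simp
      ring
  · rintro ⟨t, -, rfl⟩
    rw [← Complex.ofReal_cos, ← Complex.ofReal_ofNat, ← Complex.ofReal_mul]
    refine ⟨Complex.ofReal_im _, ?_⟩
    rw [Complex.ofReal_re, abs_mul, abs_two]
    linarith [Real.abs_cos_le_one t]

/-- The semi-major axis, in units of `2`, of the ellipse with foci `±2` through `w`. -/
noncomputable def confocalAxis (w : ℂ) : ℝ := (‖w - 2‖ + ‖w + 2‖) / 4

lemma continuous_confocalAxis : Continuous confocalAxis := by
  unfold confocalAxis
  fun_prop

lemma one_le_confocalAxis (w : ℂ) : 1 ≤ confocalAxis w := by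
  have h := norm_sub_le (w + 2) (w - 2)
  rw [show w + 2 - (w - 2) = 4 by ring, Complex.norm_ofNat] at h
  rw [confocalAxis]
  linarith

lemma norm_le_two_mul_confocalAxis (w : ℂ) : ‖w‖ ≤ 2 * confocalAxis w := by
  have h := norm_add_le (w + 2) (w - 2)
  rw [show w + 2 + (w - 2) = 2 * w by ring, norm_mul, Complex.norm_ofNat] at h
  rw [confocalAxis]
  linarith

lemma confocalAxis_le_add (w z : ℂ) : confocalAxis w ≤ confocalAxis z + ‖w - z‖ / 2 := by
  have h1 := norm_sub_le_norm_sub_add_norm_sub w z 2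
  have h2 := norm_add_le (w - z) (z + 2)
  rw [show w - z + (z + 2) = w + 2 by ring] at h2
  rw [confocalAxis, confocalAxis]
  linarith

lemma confocalAxis_eq_one {w : ℂ} (hw : w ∈ bandSet) : confocalAxis w = 1 := by
  obtain ⟨him, hre⟩ := hw
  obtain ⟨h1, h2⟩ := abs_le.1 hre
  have hw : w = (w.re : ℂ) := Complex.ext rfl (by simpa using him)
  rw [confocalAxis, hw, ← Complex.ofReal_ofNat, ← Complex.ofReal_sub, ← Complex.ofReal_add,
    Complex.norm_real, Complex.norm_real, Real.norm_eq_abs, Real.norm_eq_abs,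
    abs_of_nonpos (by linarith), abs_of_nonneg (by linarith)]
  ring

/-- The modulus of the exterior preimage of `w` under `J ↦ J + J⁻¹`. -/
noncomputable def joukowskyNorm (w : ℂ) : ℝ := confocalAxis w + √(confocalAxis w ^ 2 - 1)

lemma continuous_joukowskyNorm : Continuous joukowskyNorm :=
  continuous_confocalAxis.add ((continuous_confocalAxis.pow 2).sub continuous_const).sqrt

lemma confocalAxis_le_joukowskyNorm (w : ℂ) : confocalAxis w ≤ joukowskyNorm w :=
  le_add_of_nonneg_right (Real.sqrt_nonneg _)

lemma joukowskyNorm_pos (w : ℂ) : 0 < joukowskyNorm w :=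
  (zero_lt_one.trans_le (one_le_confocalAxis w)).trans_le (confocalAxis_le_joukowskyNorm w)

lemma joukowskyNorm_eq_one {w : ℂ} (hw : w ∈ bandSet) : joukowskyNorm w = 1 := by
  rw [joukowskyNorm, confocalAxis_eq_one hw]
  norm_num

lemma joukowskyNorm_le_of_confocalAxis_le {w z : ℂ} {s : ℝ} (hs0 : 0 ≤ s) (hs1 : s ≤ 1)
    (h : confocalAxis w ≤ (1 + s ^ 2 / 3) * confocalAxis z) :
    joukowskyNorm w ≤ (1 + 2 * s) * joukowskyNorm z := by
  have hw1 := one_le_confocalAxis w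
  have hz1 := one_le_confocalAxis z
  have hzN := confocalAxis_le_joukowskyNorm z
  have hsq := pow_le_pow_left₀ (by linarith) h 2
  have hs2 : s ^ 2 ≤ s := by nlinarith
  have hs4 : (s ^ 2) ^ 2 ≤ s ^ 2 := by nlinarith
  have hroot : √(confocalAxis w ^ 2 - 1) ≤ √(confocalAxis z ^ 2 - 1) + s * confocalAxis z := by
    refine Real.sqrt_le_iff.2 ⟨by positivity, ?_⟩
    have hS := Real.sq_sqrt (show 0 ≤ confocalAxis z ^ 2 - 1 by nlinarith)
    have hcross : 0 ≤ √(confocalAxis z ^ 2 - 1) * (s * confocalAxis z) := by positivity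
    nlinarith [mul_le_mul_of_nonneg_right hs4 (sq_nonneg (confocalAxis z))]
  calc joukowskyNorm w ≤ (1 + s ^ 2 / 3) * confocalAxis z
        + (√(confocalAxis z ^ 2 - 1) + s * confocalAxis z) := add_le_add h hroot
    _ = joukowskyNorm z + (s ^ 2 / 3 + s) * confocalAxis z := by
      rw [joukowskyNorm]
      ring
    _ ≤ joukowskyNorm z + (2 * s) * joukowskyNorm z := by
      gcongr
      nlinarith
    _ = _ := by ring

/-- The exterior inverse of the Joukowsky map `J ↦ J + J⁻¹`, analytic off `[-2, 2]`. -/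
noncomputable def joukowskyInv (w : ℂ) : ℂ := w * (1 + (1 - 4 / w ^ 2) ^ (1 / 2 : ℂ)) / 2

lemma ne_zero_of_notMem_bandSet {w : ℂ} (hw : w ∉ bandSet) : w ≠ 0 := by
  rintro rfl
  exact hw ⟨by simp, by simp⟩

lemma mem_slitPlane_of_notMem_bandSet {w : ℂ} (hw : w ∉ bandSet) :
    1 - 4 / w ^ 2 ∈ Complex.slitPlane := by
  have h0 := ne_zero_of_notMem_bandSet hw
  by_contra h
  rw [Complex.mem_slitPlane_iff, not_or, not_lt, not_not] at h
  obtain ⟨hre, him⟩ := h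
  set q : ℂ := 1 - 4 / w ^ 2 with hq
  have hqr : q = (q.re : ℂ) := Complex.ext rfl (by simpa using him)
  have hw2 : w ^ 2 * (1 - q) = 4 := by
    rw [hq]
    field_simp
    ring
  have hpos : 0 < 1 - q.re := by linarith
  rw [hqr, ← Complex.ofReal_one, ← Complex.ofReal_sub] at hw2
  have h1 := congrArg Complex.re hw2
  have h2 := congrArg Complex.im hw2
  rw [Complex.re_mul_ofReal, sq, Complex.mul_re] at h1
  rw [Complex.im_mul_ofReal, sq, Complex.mul_im] at h2
  simp only [Complex.re_ofNat, Complex.im_ofNat] at h1 h2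
  have h3 : w.re * w.im = 0 := by
    have := (mul_eq_zero.1 h2).resolve_right hpos.ne'
    linarith
  rcases mul_eq_zero.1 h3 with h4 | h4
  · rw [h4] at h1
    nlinarith [mul_nonneg (mul_self_nonneg w.im) hpos.le]
  · refine hw ⟨h4, abs_le_of_sq_le_sq ?_ (by norm_num)⟩
    rw [h4] at h1
    nlinarith [mul_nonneg (mul_self_nonneg w.re) (neg_nonneg.2 hre)]

lemma analyticAt_joukowskyInv {w : ℂ} (hw : w ∉ bandSet) : AnalyticAt ℂ joukowskyInv w := by
  have h0 := ne_zero_of_notMem_bandSet hw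
  have h1 : AnalyticAt ℂ (fun w : ℂ => 1 - 4 / w ^ 2) w :=
    analyticAt_const.sub (analyticAt_const.div (analyticAt_id.pow 2) (pow_ne_zero 2 h0))
  have h2 : AnalyticAt ℂ (fun w : ℂ => (1 - 4 / w ^ 2) ^ (1 / 2 : ℂ)) w :=
    h1.cpow analyticAt_const (mem_slitPlane_of_notMem_bandSet hw)
  exact (analyticAt_id.mul (analyticAt_const.add h2)).div analyticAt_const two_ne_zero

lemma joukowskyInv_spec {w : ℂ} (hw : w ∉ bandSet) :
    joukowskyInv w ≠ 0 ∧ joukowskyInv w + (joukowskyInv w)⁻¹ = w ∧ 1 ≤ ‖joukowskyInv w‖ := by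
  have h0 := ne_zero_of_notMem_bandSet hw
  have hslit := mem_slitPlane_of_notMem_bandSet hw
  have hr2 : ((1 - 4 / w ^ 2) ^ (1 / 2 : ℂ)) ^ 2 = 1 - 4 / w ^ 2 := by
    rw [← Complex.cpow_nat_mul]
    norm_num
  have hre : 0 ≤ ((1 - 4 / w ^ 2) ^ (1 / 2 : ℂ)).re := by
    rw [Complex.cpow_def_of_ne_zero (Complex.slitPlane_ne_zero hslit), Complex.exp_re]
    refine mul_nonneg (Real.exp_pos _).le (Real.cos_nonneg_of_mem_Icc ?_)
    have h1 := Complex.neg_pi_lt_log_im (1 - 4 / w ^ 2)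
    have h2 := Complex.log_im_le_pi (1 - 4 / w ^ 2)
    have h3 : (Complex.log (1 - 4 / w ^ 2) * (1 / 2 : ℂ)).im
        = (Complex.log (1 - 4 / w ^ 2)).im / 2 := by
      rw [show (1 / 2 : ℂ) = ((1 / 2 : ℝ) : ℂ) by push_cast; rfl, Complex.im_mul_ofReal]
      ring
    rw [h3]
    constructor <;> linarith
  rw [joukowskyInv]
  generalize (1 - 4 / w ^ 2) ^ (1 / 2 : ℂ) = r at hr2 hre
  have hprod : w * (1 + r) / 2 * (w * (1 - r) / 2) = 1 := by
    have : w ^ 2 * r ^ 2 = w ^ 2 - 4 := by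
      rw [hr2]
      field_simp
    linear_combination -this / 4
  have hinv : (w * (1 + r) / 2)⁻¹ = w * (1 - r) / 2 := inv_eq_of_mul_eq_one_right hprod
  refine ⟨left_ne_zero_of_mul_eq_one hprod, by rw [hinv]; ring, ?_⟩
  have hle : ‖w * (1 - r) / 2‖ ≤ ‖w * (1 + r) / 2‖ := by
    rw [norm_div, norm_mul, norm_div, norm_mul]
    gcongr
    refine le_of_sq_le_sq ?_ (norm_nonneg _)
    rw [Complex.sq_norm, Complex.sq_norm, Complex.normSq_apply, Complex.normSq_apply]
    simp only [Complex.sub_re, Complex.add_re, Complex.sub_im, Complex.add_im, Complex.one_re,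
      Complex.one_im]
    nlinarith
  have hn := congrArg norm hprod
  rw [norm_mul, norm_one] at hn
  nlinarith [norm_nonneg (w * (1 + r) / 2)]

lemma norm_joukowskyInv {w : ℂ} (hw : w ∉ bandSet) : ‖joukowskyInv w‖ = joukowskyNorm w := by
  obtain ⟨h0, hsum, h1⟩ := joukowskyInv_spec hw
  generalize joukowskyInv w = J at h0 hsum h1
  have hJ : 0 < ‖J‖ := norm_pos_iff.2 h0
  have hpar := parallelogram_law_with_norm ℝ J 1
  rw [norm_one] at hpar
  have hm : ‖w - 2‖ = ‖J - 1‖ * ‖J - 1‖ / ‖J‖ := by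
    rw [← norm_mul, ← norm_div, ← hsum]
    congr 1
    field_simp
    ring
  have hp : ‖w + 2‖ = ‖J + 1‖ * ‖J + 1‖ / ‖J‖ := by
    rw [← norm_mul, ← norm_div, ← hsum]
    congr 1
    field_simp
    ring
  have hu : confocalAxis w = (‖J‖ + ‖J‖⁻¹) / 2 := by
    rw [confocalAxis, hm, hp, ← add_div, ← sq, ← sq, add_comm (‖J - 1‖ ^ 2), hpar]
    field_simp
    ring
  have hinv : ‖J‖⁻¹ ≤ ‖J‖ := (inv_le_one_of_one_le₀ h1).trans h1
  rw [joukowskyNorm, hu, show ((‖J‖ + ‖J‖⁻¹) / 2) ^ 2 - 1 = ((‖J‖ - ‖J‖⁻¹) / 2) ^ 2 by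
    field_simp
    ring, Real.sqrt_sq (by linarith)]
  ring

/-! ### The full spectrum determines the discriminant -/

lemma exists_norm_hillDiscr_sub_le (a b c d : ℂ) : ∃ C > 0, ∀ k : ℂ, C ≤ ‖k‖ →
    ‖hillDiscr a b (k ^ 2) - hillDiscr c d (k ^ 2)‖ ≤ C / ‖k‖ * Real.exp |k.im| ∧
    ‖hillDiscr c d (k ^ 2) - 2 * Complex.cos k‖ ≤ C / ‖k‖ * Real.exp |k.im| := by
  refine ⟨4 * (‖a‖ + ‖b‖) + 4 * (‖c‖ + ‖d‖) + 1, by positivity, fun k hk => ?_⟩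
  have hab : 0 ≤ ‖a‖ + ‖b‖ := by positivity
  have hcd : 0 ≤ ‖c‖ + ‖d‖ := by positivity
  have hk0 : k ≠ 0 := norm_pos_iff.1 (by linarith)
  have h1 := norm_hillDiscr_sq_sub_le a b hk0 (by linarith)
  have h2 := norm_hillDiscr_sq_sub_le c d hk0 (by linarith)
  have he : 0 ≤ Real.exp |k.im| / ‖k‖ := by positivity
  rw [div_mul_eq_mul_div, mul_div_assoc] at h1 h2 ⊢
  constructor
  · have h3 := norm_sub_le_norm_sub_add_norm_sub (hillDiscr a b (k ^ 2)) (2 * Complex.cos k)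
      (hillDiscr c d (k ^ 2))
    rw [norm_sub_rev (2 * Complex.cos k)] at h3
    nlinarith
  · nlinarith

lemma exp_abs_im_le_norm_two_mul_cos (k : ℂ) :
    Real.exp |k.im| ≤ ‖2 * Complex.cos k‖ + 1 := by
  have hp : ‖Complex.exp (k * Complex.I)‖ = Real.exp (-k.im) := by
    rw [Complex.norm_exp]
    simp
  have hm : ‖Complex.exp (-k * Complex.I)‖ = Real.exp k.im := by
    rw [Complex.norm_exp]
    simp
  rw [Complex.two_cos]
  rcases le_total 0 k.im with h | h
  · have h1 := norm_le_add_norm_add (Complex.exp (-k * Complex.I)) (Complex.exp (k * Complex.I))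
    rw [hp, hm, add_comm (Complex.exp _)] at h1
    have h2 : Real.exp (-k.im) ≤ 1 := Real.exp_le_one_iff.2 (by linarith)
    rw [abs_of_nonneg h]
    linarith
  · have h1 := norm_le_add_norm_add (Complex.exp (k * Complex.I)) (Complex.exp (-k * Complex.I))
    rw [hp, hm] at h1
    have h2 : Real.exp k.im ≤ 1 := Real.exp_le_one_iff.2 h
    rw [abs_of_nonpos h]
    linarith

lemma exists_confocalAxis_hillDiscr_le (a b c d : ℂ) {κ : ℝ} (hκ : 0 < κ) :
    ∃ B, ∀ lam, B ≤ ‖lam‖ →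
      confocalAxis (hillDiscr a b lam) ≤ (1 + κ) * confocalAxis (hillDiscr c d lam) := by
  obtain ⟨C, hC, h⟩ := exists_norm_hillDiscr_sub_le a b c d
  refine ⟨(2 * C + 3 * C / κ) ^ 2, fun lam hlam => ?_⟩
  obtain ⟨k, rfl⟩ : ∃ k : ℂ, k ^ 2 = lam := IsAlgClosed.exists_pow_nat_eq lam two_pos
  have hq : 0 < 3 * C / κ := by positivity
  rw [norm_pow] at hlam
  have hk : 2 * C + 3 * C / κ ≤ ‖k‖ := le_of_sq_le_sq hlam (norm_nonneg _)
  have hk0 : 0 < ‖k‖ := by linarith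
  have hkκ : 3 * C ≤ ‖k‖ * κ := (div_le_iff₀ hκ).1 (by linarith)
  obtain ⟨h1, h2⟩ := h k (by linarith)
  have hu1 := one_le_confocalAxis (hillDiscr c d (k ^ 2))
  have hu2 := norm_le_two_mul_confocalAxis (hillDiscr c d (k ^ 2))
  have hle := confocalAxis_le_add (hillDiscr a b (k ^ 2)) (hillDiscr c d (k ^ 2))
  have hexp : Real.exp |k.im| ≤ 6 * confocalAxis (hillDiscr c d (k ^ 2)) := by
    have h3 := exp_abs_im_le_norm_two_mul_cos k
    have h4 := norm_sub_norm_le (2 * Complex.cos k) (hillDiscr c d (k ^ 2))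
    rw [norm_sub_rev] at h4
    have h5 : C / ‖k‖ ≤ 1 / 2 := by
      rw [div_le_div_iff₀ hk0 two_pos]
      linarith
    have h6 : C / ‖k‖ * Real.exp |k.im| ≤ 1 / 2 * Real.exp |k.im| := by gcongr
    linarith
  have hfin : C / ‖k‖ * Real.exp |k.im| ≤ 2 * κ * confocalAxis (hillDiscr c d (k ^ 2)) := by
    calc C / ‖k‖ * Real.exp |k.im| ≤ C / ‖k‖ * (6 * confocalAxis (hillDiscr c d (k ^ 2))) := by
          gcongr
      _ = 2 * (3 * C / ‖k‖) * confocalAxis (hillDiscr c d (k ^ 2)) := by ring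
      _ ≤ 2 * κ * confocalAxis (hillDiscr c d (k ^ 2)) := by
          gcongr
          rw [div_le_iff₀ hk0]
          linarith
  linarith

lemma differentiable_hillDiscr_lam (a b : ℂ) : Differentiable ℂ (hillDiscr a b) :=
  differentiable_hillDiscr (differentiable_const a) (differentiable_const b) differentiable_id

/-- The quotient of the exterior Joukowsky preimages of two discriminants. -/
noncomputable def joukowskyRatio (a b c d lam : ℂ) : ℂ :=
  joukowskyInv (hillDiscr a b lam) / joukowskyInv (hillDiscr c d lam)

lemma norm_joukowskyRatio {a b c d lam : ℂ} (h1 : hillDiscr a b lam ∉ bandSet)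
    (h2 : hillDiscr c d lam ∉ bandSet) :
    ‖joukowskyRatio a b c d lam‖ =
      joukowskyNorm (hillDiscr a b lam) / joukowskyNorm (hillDiscr c d lam) := by
  rw [joukowskyRatio, norm_div, norm_joukowskyInv h1, norm_joukowskyInv h2]

lemma eventually_notMem_bandSet {a b lam : ℂ} (h : hillDiscr a b lam ∉ bandSet) :
    ∀ᶠ z in nhds lam, hillDiscr a b z ∉ bandSet :=
  (differentiable_hillDiscr_lam a b).continuous.continuousAt.eventually_mem
    (isClosed_bandSet.isOpen_compl.mem_nhds h)

lemma analyticAt_joukowskyRatio {a b c d lam : ℂ} (h1 : hillDiscr a b lam ∉ bandSet)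
    (h2 : hillDiscr c d lam ∉ bandSet) : AnalyticAt ℂ (joukowskyRatio a b c d) lam :=
  ((analyticAt_joukowskyInv h1).comp ((differentiable_hillDiscr_lam a b).analyticAt lam)).div
    ((analyticAt_joukowskyInv h2).comp ((differentiable_hillDiscr_lam c d).analyticAt lam))
    (joukowskyInv_spec h2).1

lemma eventually_joukowskyRatio_eq {a b c d lam : ℂ} (h1 : hillDiscr a b lam ∉ bandSet)
    (h2 : hillDiscr c d lam ∉ bandSet)
    (hmax : ∀ z, joukowskyNorm (hillDiscr a b z) / joukowskyNorm (hillDiscr c d z) ≤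
      joukowskyNorm (hillDiscr a b lam) / joukowskyNorm (hillDiscr c d lam)) :
    ∀ᶠ z in nhds lam, joukowskyRatio a b c d z = joukowskyRatio a b c d lam := by
  refine Complex.eventually_eq_of_isLocalMax_norm
    ((analyticAt_joukowskyRatio h1 h2).eventually_analyticAt.mono fun z hz => hz.differentiableAt)
    ?_
  filter_upwards [eventually_notMem_bandSet h1, eventually_notMem_bandSet h2] with z hz1 hz2
  simp only [Function.comp_apply]
  rw [norm_joukowskyRatio hz1 hz2, norm_joukowskyRatio h1 h2]
  exact hmax z

lemma joukowskyNorm_hillDiscr_le {a b c d : ℂ}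
    (h : ∀ lam, hillDiscr a b lam ∈ bandSet ↔ hillDiscr c d lam ∈ bandSet) (lam : ℂ) :
    joukowskyNorm (hillDiscr a b lam) ≤ joukowskyNorm (hillDiscr c d lam) := by
  set m : ℂ → ℝ := fun z => joukowskyNorm (hillDiscr a b z) / joukowskyNorm (hillDiscr c d z)
    with hm
  have hcont : Continuous m :=
    (continuous_joukowskyNorm.comp (differentiable_hillDiscr_lam a b).continuous).div
      (continuous_joukowskyNorm.comp (differentiable_hillDiscr_lam c d).continuous)
      fun z => (joukowskyNorm_pos _).ne'
  have hinfty {μ : ℝ} (hμ : 1 < μ) : ∃ B, ∀ z, B ≤ ‖z‖ → m z < μ := by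
    have hs : 0 < min 1 ((μ - 1) / 4) := lt_min one_pos (by linarith)
    obtain ⟨B, hB⟩ := exists_confocalAxis_hillDiscr_le a b c d
      (κ := min 1 ((μ - 1) / 4) ^ 2 / 3) (by positivity)
    refine ⟨B, fun z hz => ?_⟩
    have h1 := joukowskyNorm_le_of_confocalAxis_le hs.le (min_le_left _ _) (hB z hz)
    rw [hm, div_lt_iff₀ (joukowskyNorm_pos _)]
    refine h1.trans_lt (mul_lt_mul_of_pos_right ?_ (joukowskyNorm_pos _))
    linarith [min_le_right 1 ((μ - 1) / 4)]
  by_contra! hlt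
  have hlam : 1 < m lam := (one_lt_div (joukowskyNorm_pos _)).2 hlt
  obtain ⟨B, hB⟩ := hinfty hlam
  obtain ⟨p, hp⟩ := hcont.exists_forall_ge' lam (by
    rw [← Metric.cobounded_eq_cocompact]
    filter_upwards [tendsto_norm_cobounded_atTop.eventually_ge_atTop B] with z hz
    exact (hB z hz).le)
  have hp1 : 1 < m p := hlam.trans_le (hp lam)
  have hclopen : IsClopen {z | m z = m p} := by
    refine ⟨isClosed_eq hcont continuous_const, isOpen_iff_mem_nhds.2 fun q hq => ?_⟩
    have hq' : m q = m p := hq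
    have hq1 : hillDiscr a b q ∉ bandSet := fun hmem => by
      have : m q = 1 := by
        rw [hm]
        simp only
        rw [joukowskyNorm_eq_one hmem, joukowskyNorm_eq_one ((h q).1 hmem), div_one]
      linarith
    have hq2 : hillDiscr c d q ∉ bandSet := fun hmem => hq1 ((h q).2 hmem)
    filter_upwards [eventually_joukowskyRatio_eq hq1 hq2 fun z => (hp z).trans_eq hq'.symm,
      eventually_notMem_bandSet hq1, eventually_notMem_bandSet hq2] with z hz hz1 hz2
    have h3 := congrArg norm hz
    rw [norm_joukowskyRatio hz1 hz2, norm_joukowskyRatio hq1 hq2] at h3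
    exact h3.trans hq'
  obtain ⟨B', hB'⟩ := hinfty hp1
  have hall : {z | m z = m p} = univ := hclopen.eq_univ ⟨p, rfl⟩
  have hmem : ((|B'| : ℝ) : ℂ) ∈ {z | m z = m p} := hall ▸ mem_univ _
  refine (hB' _ ?_).ne hmem
  rw [Complex.norm_real, Real.norm_eq_abs, abs_abs]
  exact le_abs_self B'

lemma joukowskyNorm_hillDiscr_eq {a b c d : ℂ}
    (h : ∀ lam, hillDiscr a b lam ∈ bandSet ↔ hillDiscr c d lam ∈ bandSet) (lam : ℂ) :
    joukowskyNorm (hillDiscr a b lam) = joukowskyNorm (hillDiscr c d lam) :=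
  (joukowskyNorm_hillDiscr_le h lam).antisymm (joukowskyNorm_hillDiscr_le (fun z => (h z).symm) lam)

lemma exists_large_imaginary (a b c d : ℂ) : ∃ C > 0, ∀ x : ℝ, C ≤ x →
    ‖hillDiscr a b (((x : ℂ) * Complex.I) ^ 2) - hillDiscr c d (((x : ℂ) * Complex.I) ^ 2)‖ ≤
      C / x * Real.exp x ∧
    Real.exp x / 4 ≤ ‖hillDiscr a b (((x : ℂ) * Complex.I) ^ 2)‖ ∧
    Real.exp x / 4 ≤ ‖hillDiscr c d (((x : ℂ) * Complex.I) ^ 2)‖ := by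
  obtain ⟨C, hC, h⟩ := exists_norm_hillDiscr_sub_le a b c d
  refine ⟨8 * C + 8, by positivity, fun x hx => ?_⟩
  have hx0 : 0 < x := by linarith
  have hn : ‖(x : ℂ) * Complex.I‖ = x := by
    rw [norm_mul, Complex.norm_I, mul_one, Complex.norm_real, Real.norm_eq_abs, abs_of_pos hx0]
  have hi : |((x : ℂ) * Complex.I).im| = x := by
    rw [Complex.mul_I_im, Complex.ofReal_re, abs_of_pos hx0]
  have h0 := exp_abs_im_le_norm_two_mul_cos ((x : ℂ) * Complex.I)
  obtain ⟨h1, h2⟩ := h ((x : ℂ) * Complex.I) (by linarith)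
  rw [hn, hi] at h1 h2
  rw [hi] at h0
  have hC8 : C / x * Real.exp x ≤ 1 / 8 * Real.exp x := by
    refine mul_le_mul_of_nonneg_right ?_ (Real.exp_pos x).le
    rw [div_le_div_iff₀ hx0 (by norm_num)]
    linarith
  have hx8 : 8 ≤ Real.exp x := by linarith [Real.add_one_le_exp x]
  have h3 := norm_sub_norm_le (2 * Complex.cos ((x : ℂ) * Complex.I))
    (hillDiscr c d (((x : ℂ) * Complex.I) ^ 2))
  rw [norm_sub_rev] at h3
  have h4 := norm_sub_norm_le (hillDiscr c d (((x : ℂ) * Complex.I) ^ 2))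
    (hillDiscr a b (((x : ℂ) * Complex.I) ^ 2))
  rw [norm_sub_rev] at h4
  refine ⟨h1.trans ?_, by linarith, by linarith⟩
  gcongr
  linarith

lemma notMem_bandSet_of_two_lt_norm {w : ℂ} (h : 2 < ‖w‖) : w ∉ bandSet := by
  rintro ⟨him, hre⟩
  have hw : w = (w.re : ℂ) := Complex.ext rfl (by simpa using him)
  rw [hw, Complex.norm_real, Real.norm_eq_abs] at h
  linarith

lemma hillDiscr_eq_of_mem_bandSet_iff {a b c d : ℂ}
    (h : ∀ lam, hillDiscr a b lam ∈ bandSet ↔ hillDiscr c d lam ∈ bandSet) (lam : ℂ) :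
    hillDiscr a b lam = hillDiscr c d lam := by
  obtain ⟨C, hC, hlarge⟩ := exists_large_imaginary a b c d
  obtain ⟨q, hq1, hq2⟩ : ∃ q, hillDiscr a b q ∉ bandSet ∧ hillDiscr c d q ∉ bandSet := by
    obtain ⟨-, h1, h2⟩ := hlarge (C + 8) (by linarith)
    have he := Real.add_one_le_exp (C + 8)
    exact ⟨_, notMem_bandSet_of_two_lt_norm (by linarith),
      notMem_bandSet_of_two_lt_norm (by linarith)⟩
  have hone (z : ℂ) : joukowskyNorm (hillDiscr a b z) / joukowskyNorm (hillDiscr c d z) = 1 := by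
    rw [joukowskyNorm_hillDiscr_eq h, div_self (joukowskyNorm_pos _).ne']
  have hev := eventually_joukowskyRatio_eq hq1 hq2 fun z => by rw [hone, hone]
  have hγ : joukowskyRatio a b c d q ≠ 0 :=
    div_ne_zero (joukowskyInv_spec hq1).1 (joukowskyInv_spec hq2).1
  generalize joukowskyRatio a b c d q = γ at hev hγ
  have hrel : ∀ z, hillDiscr a b z ^ 2 + hillDiscr c d z ^ 2
      - (γ + γ⁻¹) * (hillDiscr a b z * hillDiscr c d z) = -(γ - γ⁻¹) ^ 2 := by
    have hF := differentiable_hillDiscr_lam a b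
    have hG := differentiable_hillDiscr_lam c d
    refine eq_const_of_frequently (z₀ := q) (by fun_prop)
      (Filter.Eventually.frequently (Filter.Eventually.filter_mono nhdsWithin_le_nhds ?_))
    filter_upwards [hev, eventually_notMem_bandSet hq1, eventually_notMem_bandSet hq2]
      with z hz hz1 hz2
    obtain ⟨hF0, hFs, -⟩ := joukowskyInv_spec hz1
    obtain ⟨hG0, hGs, -⟩ := joukowskyInv_spec hz2
    rw [joukowskyRatio, div_eq_iff hG0] at hz
    rw [hz] at hFs
    generalize joukowskyInv (hillDiscr c d z) = J at hFs hGs hG0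
    rw [← hFs, ← hGs]
    field_simp
    ring
  have hdiff (z : ℂ) : (hillDiscr a b z - hillDiscr c d z) ^ 2 =
      (γ + γ⁻¹ - 2) * (hillDiscr a b z * hillDiscr c d z) - (γ - γ⁻¹) ^ 2 := by
    linear_combination hrel z
  have hγ2 : γ + γ⁻¹ - 2 = 0 := by
    by_contra hne
    obtain ⟨A, hA⟩ : ∃ A, A = ‖γ + γ⁻¹ - 2‖ := ⟨_, rfl⟩
    obtain ⟨K, hK⟩ : ∃ K, K = ‖(γ - γ⁻¹) ^ 2‖ := ⟨_, rfl⟩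
    have hpos : 0 < A := hA ▸ norm_pos_iff.2 hne
    have hK0 : 0 ≤ K := hK ▸ norm_nonneg _
    set x : ℝ := C + 1 + 16 * (C ^ 2 + K + 1) / A with hx
    have hq0 : 0 < 16 * (C ^ 2 + K + 1) / A := by positivity
    have hx1 : 1 ≤ x := by linarith
    obtain ⟨h1, h2, h3⟩ := hlarge x (by linarith)
    have h4 := congrArg norm (hdiff (((x : ℂ) * Complex.I) ^ 2))
    rw [norm_pow] at h4
    have h5 := norm_sub_norm_le ((γ + γ⁻¹ - 2) * (hillDiscr a b (((x : ℂ) * Complex.I) ^ 2)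
      * hillDiscr c d (((x : ℂ) * Complex.I) ^ 2))) ((γ - γ⁻¹) ^ 2)
    rw [← h4, norm_mul, norm_mul, ← hA, ← hK] at h5
    have h6 := pow_le_pow_left₀ (norm_nonneg _) h1 2
    have h7 : A * (Real.exp x / 4 * (Real.exp x / 4)) ≤
        A * (‖hillDiscr a b (((x : ℂ) * Complex.I) ^ 2)‖
          * ‖hillDiscr c d (((x : ℂ) * Complex.I) ^ 2)‖) := by gcongr
    have hx0 : 0 < x := by linarith
    have hex : x ≤ Real.exp x := by linarith [Real.add_one_le_exp x]
    have h8 : A * x ^ 2 * Real.exp x ^ 2 ≤ 16 * (K + C ^ 2) * Real.exp x ^ 2 := by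
      have h9 : (C / x * Real.exp x) ^ 2 * x ^ 2 = C ^ 2 * Real.exp x ^ 2 := by field_simp
      have h10 : A * Real.exp x ^ 2 ≤ 16 * (K + (C / x * Real.exp x) ^ 2) := by linarith
      have h11 := mul_le_mul_of_nonneg_right h10 (sq_nonneg x)
      have h12 : K * x ^ 2 ≤ K * Real.exp x ^ 2 := by gcongr
      linarith
    have h9 := le_of_mul_le_mul_right h8 (by positivity)
    have h10 : 16 * (C ^ 2 + K + 1) ≤ x * A := (div_le_iff₀ hpos).1 (by linarith)
    nlinarith
  rw [sub_eq_zero] at hγ2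
  have hγ1 : γ = 1 := by
    have h1 : (γ - 1) ^ 2 = 0 := by
      have h2 : γ * (γ + γ⁻¹) = γ * 2 := by rw [hγ2]
      rw [mul_add, mul_inv_cancel₀ hγ] at h2
      linear_combination h2
    exact sub_eq_zero.1 (pow_eq_zero_iff two_ne_zero |>.1 h1)
  have h1 := hdiff lam
  rw [hγ1] at h1
  norm_num at h1
  exact sub_eq_zero.1 h1

theorem isospectrality_tfae (a b c d : ℂ) :
    List.TFAE
      [ a * b = c * d,
        ∀ t ∈ Set.Ioc (-Real.pi) Real.pi, ∀ lam : ℂ,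
          IsEigenvalueH a b t lam ↔ IsEigenvalueH c d t lam,
        ∃ t ∈ Set.Ioc (-Real.pi) Real.pi, ∀ lam : ℂ,
          IsEigenvalueH a b t lam ↔ IsEigenvalueH c d t lam,
        ∀ lam : ℂ,
          (∃ t ∈ Set.Ioc (-Real.pi) Real.pi, IsEigenvalueH a b t lam) ↔
            (∃ t ∈ Set.Ioc (-Real.pi) Real.pi, IsEigenvalueH c d t lam) ] := by
  tfae_have 1 → 2 := fun h t _ lam => by
    rw [isEigenvalueH_iff, isEigenvalueH_iff, hillDiscr_eq_of_mul_eq h]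
  tfae_have 2 → 3 := fun h =>
    ⟨Real.pi, right_mem_Ioc.2 (by linarith [Real.pi_pos]), h _
      (right_mem_Ioc.2 (by linarith [Real.pi_pos]))⟩
  tfae_have 2 → 4 := fun h lam =>
    exists_congr fun t => and_congr_right fun ht => h t ht lam
  tfae_have 3 → 1 := fun ⟨_, _, h⟩ => mul_eq_mul_of_isEigenvalueH_iff h
  tfae_have 4 → 1 := fun h => by
    simp only [isEigenvalueH_iff, ← mem_bandSet_iff] at h
    refine mul_eq_mul_of_isEigenvalueH_iff (t := 0) fun lam => ?_
    rw [isEigenvalueH_iff, isEigenvalueH_iff, hillDiscr_eq_of_mem_bandSet_iff h]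
  tfae_finish
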